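/- arXiv:1002.1229 — 3 statements merged into one kernel-verified Lean document; each statement's English description precedes it below -/
import Mathlib

section
/- For every n ≥ 0, the number of centrosymmetric involutions of {1,2,…,n+1} that avoid both of the patterns 1243 and 2143 equals the number of Schröder paths p ∈ D_n satisfying rev(p) = p and having no features. -/
/-- A step of a lattice path: `E = (1,0)`, `N = (0,1)`, `D = (1,1)`. -/
inductive Step : Type
  | E : Step
  | N : Step
  | D : Step
  deriving DecidableEq

/-- The x-coordinate of the lattice point reached after performing the steps `q`
(starting from the origin). -/
def posX (q : List Step) : ℕ := q.count Step.E + q.count Step.D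

/-- The y-coordinate of the lattice point reached after performing the steps `q`
(starting from the origin). -/
def posY (q : List Step) : ℕ := q.count Step.N + q.count Step.D

/-- A Schröder prefix: a lattice path starting at the origin which never passes
below the line `y = x`. -/
def IsSchroderPrefix (p : List Step) : Prop :=
  ∀ q : List Step, q <+: p → posX q ≤ posY q

/-- A Schröder path of length `n`: a Schröder prefix terminating at `(n, n)`. -/
def IsSchroderPath (n : ℕ) (p : List Step) : Prop :=
  IsSchroderPrefix p ∧ posX p = n ∧ posY p = n

/-- Interchange `E` and `N` steps. -/
def revStep : Step → Step
  | Step.E => Step.N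
  | Step.N => Step.E
  | Step.D => Step.D

/-- The reversal of a Schröder path: write the steps in reverse order and
interchange `E` and `N` steps. -/
def revPath (p : List Step) : List Step := p.reverse.map revStep

/-- Words which are concatenations of blocks, each block being a single `D` step or
of the form `N^k E^k` for some `k > 0`. -/
inductive IsInnerWord : List Step → Prop
  | nil : IsInnerWord []
  | dcons {p : List Step} : IsInnerWord p → IsInnerWord (Step.D :: p)
  | peak {k : ℕ} {p : List Step} : 0 < k → IsInnerWord p →
      IsInnerWord (List.replicate k Step.N ++ List.replicate k Step.E ++ p)

/-- Words which are concatenations of blocks, each block being a single `D` step or of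
the form `N q E` where `q` is an inner word. -/
inductive IsDWord : List Step → Prop
  | nil : IsDWord []
  | dcons {p : List Step} : IsDWord p → IsDWord (Step.D :: p)
  | block {q p : List Step} : IsInnerWord q → IsDWord p →
      IsDWord (Step.N :: (q ++ Step.E :: p))

/-- Membership in `𝒟_n`: a Schröder path of length `n` of the prescribed block form. -/
def MemD (n : ℕ) (p : List Step) : Prop := IsDWord p ∧ IsSchroderPath n p

/-- Membership in `𝒟`: Schröder prefixes occurring as initial segments of some
path in `𝒟_m` for some finite `m`. -/
def MemCalD (p : List Step) : Prop := ∃ (m : ℕ) (q : List Step), p <+: q ∧ MemD m q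

/-- `p` has a level feature at `t`: a `D` step joining `(t-1, t)` to `(t, t+1)`. -/
def HasLevelFeatureAt (p : List Step) (t : ℕ) : Prop :=
  1 ≤ t ∧ ∃ q r : List Step, p = q ++ Step.D :: r ∧ posX q = t - 1 ∧ posY q = t

/-- `p` has a notch feature at `t`: an `E` step joining `(t-1, t)` to `(t, t)`
immediately followed by an `N` step joining `(t, t)` to `(t, t+1)`. -/
def HasNotchFeatureAt (p : List Step) (t : ℕ) : Prop :=
  1 ≤ t ∧ ∃ q r : List Step, p = q ++ Step.E :: Step.N :: r ∧ posX q = t - 1 ∧ posY q = t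

/-- `p` has no (level or notch) features. -/
def Featureless (p : List Step) : Prop :=
  ∀ t : ℕ, ¬ HasLevelFeatureAt p t ∧ ¬ HasNotchFeatureAt p t

/-- Auxiliary function for `psi`, processing the path left to right while keeping track of
the current height `y - x` above the diagonal: at height `1`, a `D` step (a level feature)
is replaced by `E N` (a notch feature) and vice versa; all other steps are unchanged. -/
def psiAux : ℕ → List Step → List Step
  | 1, Step.D :: rest => Step.E :: Step.N :: psiAux 1 rest
  | 1, Step.E :: Step.N :: rest => Step.D :: psiAux 1 rest
  | h, Step.N :: rest => Step.N :: psiAux (h + 1) rest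
  | h, Step.E :: rest => Step.E :: psiAux (h - 1) rest
  | h, Step.D :: rest => Step.D :: psiAux h rest
  | _, [] => []
  termination_by h l => l.length

/-- `psi p` replaces every level feature of `p` by a notch feature at the same place and
vice versa, leaving all other steps unchanged. -/
def psi (p : List Step) : List Step := psiAux 0 p

/-- `a i`: the number of Schröder prefixes in `𝒟` terminating at `(i, i)`. -/
noncomputable def aSeq (i : ℕ) : ℕ :=
  Set.ncard {p : List Step | MemCalD p ∧ posX p = i ∧ posY p = i}

/-- `b i`: the number of Schröder prefixes in `𝒟` terminating at `(i-1, i)` (and `b 0 = 0`). -/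
noncomputable def bSeq (i : ℕ) : ℕ :=
  Set.ncard {p : List Step | MemCalD p ∧ posX p + 1 = i ∧ posY p = i}

/-- `c i`: the number of featureless Schröder prefixes in `𝒟` terminating at `(i, i)`. -/
noncomputable def cSeq (i : ℕ) : ℕ :=
  Set.ncard {p : List Step | MemCalD p ∧ Featureless p ∧ posX p = i ∧ posY p = i}

/-- `d i`: the number of featureless Schröder prefixes in `𝒟` terminating at `(i-1, i)`
(and `d 0 = 0`). -/
noncomputable def dSeq (i : ℕ) : ℕ :=
  Set.ncard {p : List Step | MemCalD p ∧ Featureless p ∧ posX p + 1 = i ∧ posY p = i}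

/-- The permutation `π` (of `{1, …, n}`, 0-indexed as `Fin n`) contains the pattern `τ`
(a permutation of `{1, …, k}`, 0-indexed as `Fin k`). -/
def Contains {n k : ℕ} (π : Equiv.Perm (Fin n)) (τ : Equiv.Perm (Fin k)) : Prop :=
  ∃ f : Fin k → Fin n, StrictMono f ∧ ∀ a b : Fin k, τ a < τ b ↔ π (f a) < π (f b)

/-- The permutation `π` avoids the pattern `τ`. -/
def Avoids {n k : ℕ} (π : Equiv.Perm (Fin n)) (τ : Equiv.Perm (Fin k)) : Prop :=
  ¬ Contains π τ

/-- The reverse-complement of a permutation: `rc π (i) = (n+1) - π (n+1-i)` (1-indexed),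
i.e. `rc π (i) = rev (π (rev i))` in 0-indexed form. -/
def rc {n : ℕ} (π : Equiv.Perm (Fin n)) : Equiv.Perm (Fin n) :=
  (Fin.revPerm.trans π).trans Fin.revPerm

/-- The pattern `1243` (0-indexed: `0 ↦ 0, 1 ↦ 1, 2 ↦ 3, 3 ↦ 2`). -/
def pat1243 : Equiv.Perm (Fin 4) := Equiv.swap 2 3

/-- The pattern `2143` (0-indexed: `0 ↦ 1, 1 ↦ 0, 2 ↦ 3, 3 ↦ 2`). -/
def pat2143 : Equiv.Perm (Fin 4) := Equiv.swap 0 1 * Equiv.swap 2 3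

/-- The pattern `2134` (0-indexed: `0 ↦ 1, 1 ↦ 0, 2 ↦ 2, 3 ↦ 3`). -/
def pat2134 : Equiv.Perm (Fin 4) := Equiv.swap 0 1


/-! ### The common data -/

/-- total size of runs (each entry `k` is a run of size `k+1`) -/
def rSize : List ℕ → ℕ
  | [] => 0
  | k :: l => (k + 1) + rSize l

def cSize : Option (List ℕ) → ℕ
  | none => 1
  | some l => rSize l + 2

def xSize : List (Option (List ℕ)) → ℕ
  | [] => 0
  | c :: x => cSize c + xSize x

def cRev : Option (List ℕ) → Option (List ℕ)
  | none => none
  | some l => some l.reverse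

def xRev (x : List (Option (List ℕ))) : List (Option (List ℕ)) := (x.map cRev).reverse

theorem rSize_append (l m : List ℕ) : rSize (l ++ m) = rSize l + rSize m := by
  induction l with
  | nil => simp [rSize]
  | cons k l ih => simp [rSize, ih]; omega

theorem rSize_reverse (l : List ℕ) : rSize l.reverse = rSize l := by
  induction l with
  | nil => simp [rSize]
  | cons k l ih => simp [rSize, ih, rSize_append]; omega

theorem cSize_rev (c : Option (List ℕ)) : cSize (cRev c) = cSize c := by
  cases c <;> simp [cRev, cSize, rSize_reverse]

theorem xSize_append (l m : List (Option (List ℕ))) : xSize (l ++ m) = xSize l + xSize m := by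
  induction l with
  | nil => simp [xSize]
  | cons k l ih => simp [xSize, ih]; omega

theorem xRev_cons (c : Option (List ℕ)) (x) : xRev (c :: x) = xRev x ++ [cRev c] := by
  simp [xRev]

theorem xSize_rev (x : List (Option (List ℕ))) : xSize (xRev x) = xSize x := by
  induction x with
  | nil => simp [xRev]
  | cons k l ih => rw [xRev_cons, xSize_append, ih]; simp [xSize, cSize_rev]; omega

theorem cSize_pos (c : Option (List ℕ)) : 0 < cSize c := by
  cases c <;> simp [cSize]

/-! ### The involutions -/

def runs : List ℕ → ℕ → ℕ
  | [], i => i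
  | k :: l, i => if i < k + 1 then k - i else (k + 1) + runs l (i - (k + 1))

def cFun : Option (List ℕ) → ℕ → ℕ
  | none, i => i
  | some l, i => if i = 0 then rSize l + 1 else if i = rSize l + 1 then 0 else 1 + runs l (i - 1)

def sig : List (Option (List ℕ)) → ℕ → ℕ
  | [], i => i
  | c :: x, i => if i < cSize c then cFun c i else cSize c + sig x (i - cSize c)

theorem runs_lt (l : List ℕ) : ∀ i, i < rSize l → runs l i < rSize l := by
  induction l with
  | nil => simp [rSize]
  | cons k l ih =>
    intro i hi
    simp only [rSize, runs] at *
    split_ifs with h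
    · omega
    · have := ih (i - (k+1)) (by omega)
      omega

theorem runs_ge (l : List ℕ) : ∀ i, rSize l ≤ i → runs l i = i := by
  induction l with
  | nil => simp [runs]
  | cons k l ih =>
    intro i hi
    simp only [rSize, runs] at *
    rw [if_neg (by omega), ih _ (by omega)]; omega

theorem runs_invol (l : List ℕ) : ∀ i, i < rSize l → runs l (runs l i) = i := by
  induction l with
  | nil => simp [rSize]
  | cons k l ih =>
    intro i hi
    simp only [rSize] at hi
    by_cases h : i < k + 1
    · simp only [runs, if_pos h]
      rw [if_pos (by omega)]; omega
    · have := ih (i - (k+1)) (by omega)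
      simp only [runs, if_neg h]
      rw [if_neg (by omega), Nat.add_sub_cancel_left, this]; omega

theorem runs_append (l m : List ℕ) : ∀ i, runs (l ++ m) i =
    if i < rSize l then runs l i else rSize l + runs m (i - rSize l) := by
  induction l with
  | nil => simp [rSize]
  | cons k l ih =>
    intro i
    have hs : rSize (k :: l) = k + 1 + rSize l := rfl
    rw [hs]
    simp only [runs, List.cons_append]
    by_cases h : i < k + 1
    · rw [if_pos h, if_pos h, if_pos (by omega)]
    · rw [if_neg h, if_neg h, ih]
      by_cases h2 : i < k + 1 + rSize l
      · rw [if_pos h2, if_pos (by omega)]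
      · rw [if_neg h2, if_neg (by omega), Nat.sub_sub]; omega

theorem runs_reverse (l : List ℕ) : ∀ i, i < rSize l →
    runs l.reverse i = rSize l - 1 - runs l (rSize l - 1 - i) := by
  induction l with
  | nil => simp [rSize]
  | cons k l ih =>
    intro i hi
    rw [List.reverse_cons, runs_append, rSize_reverse]
    simp only [rSize] at *
    by_cases h : i < rSize l
    · rw [if_pos h, ih i h]
      have h3 := runs_lt l (rSize l - 1 - i) (by omega)
      simp only [runs]
      rw [if_neg (by omega)]
      have : k + 1 + rSize l - 1 - i - (k+1) = rSize l - 1 - i := by omega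
      rw [this]; omega
    · rw [if_neg h]
      simp only [runs]
      rw [if_pos (by omega), if_pos (by omega)]; omega

theorem runs_avoid (l : List ℕ) : ∀ y c d, y < c → c < d → d < rSize l →
    runs l c < runs l d → runs l d < runs l y → False := by
  induction l with
  | nil => simp [rSize]
  | cons k l ih =>
    intro y c d h1 h2 h3 h4 h5
    simp only [rSize] at h3
    by_cases hy : y < k + 1
    · by_cases hd : d < k + 1
      · simp only [runs] at h4 h5
        rw [if_pos (by omega), if_pos hd] at h4
        omega
      · simp only [runs] at h4 h5
        rw [if_neg hd, if_pos hy] at h5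
        omega
    · simp only [runs] at h4 h5
      rw [if_neg (by omega), if_neg (by omega)] at h4 h5
      exact ih (y - (k+1)) (c - (k+1)) (d - (k+1)) (by omega) (by omega) (by omega)
        (by omega) (by omega)

theorem cFun_lt (c) (i) (h : i < cSize c) : cFun c i < cSize c := by
  cases c with
  | none => simpa [cFun] using h
  | some l =>
    simp only [cFun, cSize] at *
    split_ifs with h1 h2
    · omega
    · omega
    · have := runs_lt l (i-1) (by omega)
      omega

theorem cFun_invol (c) (i) (h : i < cSize c) : cFun c (cFun c i) = i := by
  cases c with
  | none => simp [cFun]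
  | some l =>
    simp only [cSize] at *
    by_cases h1 : i = 0
    · simp [cFun, h1]
    · by_cases h2 : i = rSize l + 1
      · simp [cFun, h2]
      · have h3 := runs_lt l (i-1) (by omega)
        have h4 := runs_invol l (i-1) (by omega)
        simp only [cFun, if_neg h1, if_neg h2]
        rw [if_neg (by omega), if_neg (by omega), Nat.add_sub_cancel_left, h4]; omega

theorem cFun_rev (c) (i) (h : i < cSize c) :
    cFun (cRev c) i = cSize c - 1 - cFun c (cSize c - 1 - i) := by
  cases c with
  | none => simp only [cSize, cFun, cRev] at *; omega
  | some l =>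
    have hs : cSize (some l) = rSize l + 2 := rfl
    rw [hs] at h ⊢
    simp only [cFun, cRev]
    rw [rSize_reverse]
    by_cases h1 : i = 0
    · rw [if_pos h1, if_neg (by omega), if_pos (by omega)]; omega
    · by_cases h2 : i = rSize l + 1
      · rw [if_neg h1, if_pos h2, if_pos (by omega)]; omega
      · rw [if_neg h1, if_neg h2, if_neg (by omega), if_neg (by omega), runs_reverse _ _ (by omega)]
        have : rSize l + 2 - 1 - i - 1 = rSize l - 1 - (i-1) := by omega
        rw [this]
        have h3 := runs_lt l (rSize l - 1 - (i-1)) (by omega)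
        omega

theorem cFun_avoid (e) (x y c d) (h0 : x < y) (h1 : y < c) (h2 : c < d) (h3 : d < cSize e)
    (h4 : cFun e c < cFun e d) (h5 : cFun e d < cFun e y) : False := by
  cases e with
  | none => simp only [cSize] at h3; omega
  | some l =>
    simp only [cSize, cFun] at *
    rw [if_neg (by omega), if_neg (by omega)] at h4
    rw [if_neg (by omega : ¬ d = 0), if_neg (by omega : ¬ y = 0), if_neg (by omega : ¬ y = _)] at h5
    by_cases hd : d = rSize l + 1
    · rw [if_neg (by omega), if_pos hd] at h4
      omega
    · rw [if_neg (by omega), if_neg hd] at h4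
      rw [if_neg hd] at h5
      exact runs_avoid l (y-1) (c-1) (d-1) (by omega) (by omega) (by omega) (by omega) (by omega)

theorem sig_lt (x) : ∀ i, i < xSize x → sig x i < xSize x := by
  induction x with
  | nil => simp [xSize]
  | cons c x ih =>
    intro i hi
    simp only [xSize, sig] at *
    split_ifs with h
    · have := cFun_lt c i h
      omega
    · have := ih (i - cSize c) (by omega)
      omega

theorem sig_ge (x) : ∀ i, xSize x ≤ i → sig x i = i := by
  induction x with
  | nil => simp [sig]
  | cons c x ih =>
    intro i hi
    simp only [xSize, sig] at *
    rw [if_neg (by omega), ih _ (by omega)]; omega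

theorem sig_invol (x) : ∀ i, i < xSize x → sig x (sig x i) = i := by
  induction x with
  | nil => simp [xSize]
  | cons c x ih =>
    intro i hi
    simp only [xSize] at hi
    by_cases h : i < cSize c
    · simp only [sig, if_pos h]
      rw [if_pos (cFun_lt c i h), cFun_invol c i h]
    · have := ih (i - cSize c) (by omega)
      simp only [sig, if_neg h]
      rw [if_neg (by omega), Nat.add_sub_cancel_left, this]; omega

theorem sig_append (l m) : ∀ i, sig (l ++ m) i =
    if i < xSize l then sig l i else xSize l + sig m (i - xSize l) := by
  induction l with
  | nil => simp [xSize]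
  | cons c l ih =>
    intro i
    have hs : xSize (c :: l) = cSize c + xSize l := rfl
    rw [hs]
    simp only [sig, List.cons_append]
    by_cases h : i < cSize c
    · rw [if_pos h, if_pos h, if_pos (by omega)]
    · rw [if_neg h, if_neg h, ih]
      by_cases h2 : i < cSize c + xSize l
      · rw [if_pos h2, if_pos (by omega)]
      · rw [if_neg h2, if_neg (by omega), Nat.sub_sub]; omega

theorem sig_rev (x) : ∀ i, i < xSize x →
    sig (xRev x) i = xSize x - 1 - sig x (xSize x - 1 - i) := by
  induction x with
  | nil => simp [xSize]
  | cons c x ih =>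
    intro i hi
    rw [xRev_cons, sig_append, xSize_rev]
    simp only [xSize] at *
    by_cases h : i < xSize x
    · rw [if_pos h, ih i h]
      have h3 := sig_lt x (xSize x - 1 - i) (by omega)
      simp only [sig]
      rw [if_neg (by omega)]
      have : cSize c + xSize x - 1 - i - cSize c = xSize x - 1 - i := by omega
      rw [this]; omega
    · rw [if_neg h]
      simp only [sig, cSize_rev]
      rw [if_pos (by omega), if_pos (by omega), cFun_rev c _ (by omega)]
      have : cSize c - 1 - (i - xSize x) = cSize c + xSize x - 1 - i := by omega
      rw [this]
      have h3 := cFun_lt c (cSize c + xSize x - 1 - i) (by omega)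
      omega

theorem sig_avoid (e) : ∀ x y c d, x < y → y < c → c < d → d < xSize e →
    sig e c < sig e d → sig e d < sig e x → sig e d < sig e y → False := by
  induction e with
  | nil => simp [xSize]
  | cons k l ih =>
    intro x y c d h0 h1 h2 h3 h4 h5 h6
    simp only [xSize] at h3
    by_cases hx : x < cSize k
    · have hx' := cFun_lt k x hx
      by_cases hd : d < cSize k
      · simp only [sig] at h4 h5 h6
        rw [if_pos (by omega), if_pos hd] at h4
        rw [if_pos (by omega), if_pos (by omega)] at h6
        exact cFun_avoid k x y c d h0 h1 h2 hd h4 h6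
      · simp only [sig] at h5
        rw [if_neg hd, if_pos hx] at h5
        omega
    · simp only [sig] at h4 h5 h6
      rw [if_neg (by omega), if_neg (by omega)] at h4 h5 h6
      exact ih (x - cSize k) (y - cSize k) (c - cSize k) (d - cSize k) (by omega) (by omega)
        (by omega) (by omega) (by omega) (by omega) (by omega)

/-! injectivity -/

theorem runs_inj (l : List ℕ) : ∀ m, rSize l = rSize m → (∀ i < rSize l, runs l i = runs m i) →
    l = m := by
  induction l with
  | nil =>
    intro m h _
    cases m with
    | nil => rfl
    | cons k m => simp only [rSize] at h; omega
  | cons k l ih =>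
    intro m h hf
    cases m with
    | nil => simp [rSize] at h
    | cons k' m =>
      have h0 := hf 0 (by simp [rSize])
      simp [runs] at h0
      subst h0
      simp only [rSize] at h hf
      congr 1
      apply ih m (by omega)
      intro i hi
      have := hf (i + (k+1)) (by omega)
      simp only [runs] at this
      rw [if_neg (by omega), if_neg (by omega), Nat.add_sub_cancel] at this
      omega

theorem sig_inj (x) : ∀ y, xSize x = xSize y → (∀ i < xSize x, sig x i = sig y i) → x = y := by
  induction x with
  | nil =>
    intro m h _
    cases m with
    | nil => rfl
    | cons k m => have := cSize_pos k; simp [xSize] at h; omega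
  | cons c x ih =>
    intro m h hf
    cases m with
    | nil => have := cSize_pos c; simp [xSize] at h; omega
    | cons c' y =>
      have hc := cSize_pos c
      have hc' := cSize_pos c'
      have h0 := hf 0 (by simp [xSize]; omega)
      simp only [sig, if_pos hc, if_pos hc'] at h0
      have hcc : c = c' := by
        cases c with
        | none =>
          cases c' with
          | none => rfl
          | some l' => simp [cFun] at h0
        | some l =>
          cases c' with
          | none => simp [cFun] at h0
          | some l' =>
            simp [cFun] at h0
            congr 1
            apply runs_inj _ _ h0
            intro i hi
            have := hf (i+1) (by simp [xSize, cSize]; omega)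
            have hs : cSize (some l) = rSize l + 2 := rfl
            have hs' : cSize (some l') = rSize l' + 2 := rfl
            simp only [sig] at this
            rw [if_pos (by omega), if_pos (by omega)] at this
            simp only [cFun] at this
            rw [if_neg (by omega), if_neg (by omega),
              if_neg (by omega), if_neg (by omega), Nat.add_sub_cancel] at this
            omega
      subst hcc
      simp only [xSize] at h hf
      congr 1
      apply ih y (by omega)
      intro i hi
      have := hf (i + cSize c) (by omega)
      simp only [sig] at this
      rw [if_neg (by omega), if_neg (by omega), Nat.add_sub_cancel] at this
      omega

/-! surjectivity -/

theorem antitone_rev (g : ℕ → ℕ) (k : ℕ) (hlt : ∀ i ≤ k, g i ≤ k)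
    (ha : ∀ i j, i < j → j ≤ k → g j < g i) : ∀ i ≤ k, g i = k - i := by
  have h1 : ∀ i ≤ k, g i + i ≤ k := by
    intro i
    induction i with
    | zero => intro h; simpa using hlt 0 h
    | succ i ih =>
      intro h
      have := ih (by omega)
      have := ha i (i+1) (by omega) h
      omega
  have h2 : ∀ j i, i + j = k → j ≤ g i := by
    intro j
    induction j with
    | zero => intros; omega
    | succ j ih =>
      intro i h
      have := ih (i+1) (by omega)
      have := ha i (i+1) (by omega) (by omega)
      omega
  intro i hi
  have := h1 i hi
  have := h2 (k - i) i (by omega)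
  omega

theorem runs_surj : ∀ N (g : ℕ → ℕ), (∀ i < N, g i < N) → (∀ i < N, g (g i) = i) →
    (∀ y c d, y < c → c < d → d < N → g c < g d → g d < g y → False) →
    ∃ l, rSize l = N ∧ ∀ i < N, g i = runs l i := by
  intro N
  induction N using Nat.strong_induction_on with
  | _ N ih =>
    intro g hlt hinv hav
    rcases Nat.eq_zero_or_pos N with h0 | hN
    · exact ⟨[], by simp [rSize, h0], by intro i hi; omega⟩
    obtain ⟨k, hk⟩ : ∃ k, g 0 = k := ⟨_, rfl⟩
    have hkN : k < N := hk ▸ hlt 0 hN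
    have hgk : g k = 0 := by rw [← hk]; exact hinv 0 hN
    have inj : ∀ i j, i < N → j < N → g i = g j → i = j := by
      intro i j hi hj h
      rw [← hinv i hi, h, hinv j hj]
    have hle : ∀ i ≤ k, g i ≤ k := by
      intro i hi
      by_contra hcon
      have hi0 : i ≠ 0 := by rintro rfl; omega
      have hik : i ≠ k := by rintro rfl; omega
      have := hinv i (by omega)
      exact hav 0 k (g i) (by omega) (by omega) (hlt i (by omega)) (by omega) (by omega)
    have hanti : ∀ i j, i < j → j ≤ k → g j < g i := by
      intro i j hij hj
      have h1 := hle i (by omega)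
      have h2 := hle j hj
      have hne : g i ≠ g j := fun h => by have := inj i j (by omega) (by omega) h; omega
      have hne0 : g 0 ≠ g j := fun h => by have := inj 0 j (by omega) (by omega) h; omega
      by_contra hcon
      rcases Nat.eq_zero_or_pos i with h | h
      · subst h; omega
      · exact hav 0 i j h hij (by omega) (by omega) (by omega)
    have hrun := antitone_rev g k hle hanti
    have hgt : ∀ i, k < i → i < N → k < g i := by
      intro i hi hiN
      by_contra hcon
      have := hle (g i) (by omega)
      have := hinv i hiN
      omega
    obtain ⟨l, hl, hf⟩ := ih (N - (k+1)) (by omega) (fun i => g (i + (k+1)) - (k+1))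
      (by
        intro i hi
        have := hlt (i + (k+1)) (by omega)
        have := hgt (i + (k+1)) (by omega) (by omega)
        omega)
      (by
        intro i hi
        have h1 := hgt (i + (k+1)) (by omega) (by omega)
        have h2 := hinv (i + (k+1)) (by omega)
        rw [Nat.sub_add_cancel (by omega), h2]; omega)
      (by
        intro y c d h1 h2 h3 h4 h5
        exact hav (y + (k+1)) (c + (k+1)) (d + (k+1)) (by omega) (by omega) (by omega)
          (by omega) (by omega))
    refine ⟨k :: l, by simp only [rSize]; omega, ?_⟩
    intro i hi
    simp only [runs]
    split_ifs with h
    · exact hrun i (by omega)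
    · have h1 := hf (i - (k+1)) (by omega)
      rw [Nat.sub_add_cancel (by omega)] at h1
      have h2 := hgt i (by omega) hi
      omega

theorem sig_surj : ∀ N (g : ℕ → ℕ), (∀ i < N, g i < N) → (∀ i < N, g (g i) = i) →
    (∀ x y c d, x < y → y < c → c < d → d < N → g c < g d → g d < g x → g d < g y → False) →
    ∃ l, xSize l = N ∧ ∀ i < N, g i = sig l i := by
  intro N
  induction N using Nat.strong_induction_on with
  | _ N ih =>
    intro g hlt hinv hav
    rcases Nat.eq_zero_or_pos N with h0 | hN
    · exact ⟨[], by simp [xSize, h0], by intro i hi; omega⟩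
    obtain ⟨k, hk⟩ : ∃ k, g 0 = k := ⟨_, rfl⟩
    have hkN : k < N := hk ▸ hlt 0 hN
    have hgk : g k = 0 := by rw [← hk]; exact hinv 0 hN
    have inj : ∀ i j, i < N → j < N → g i = g j → i = j := by
      intro i j hi hj h
      rw [← hinv i hi, h, hinv j hj]
    have hle : ∀ i ≤ k, g i ≤ k := by
      intro i hi
      by_contra hcon
      have hi0 : i ≠ 0 := by rintro rfl; omega
      have hik : i ≠ k := by rintro rfl; omega
      have := hinv i (by omega)
      exact hav 0 i k (g i) (by omega) (by omega) (by omega) (hlt i (by omega)) (by omega)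
        (by omega) (by omega)
    have hcomp : ∃ c, cSize c = k + 1 ∧ ∀ i < k + 1, g i = cFun c i := by
      rcases Nat.eq_zero_or_pos k with h | h
      · refine ⟨none, by simp [cSize, h], ?_⟩
        intro i hi
        have : i = 0 := by omega
        subst this
        simp [cFun, hk, h]
      · have hin : ∀ i, 0 < i → i < k → 0 < g i ∧ g i < k := by
          intro i h1 h2
          have h3 := hle i (by omega)
          have h4 : g i ≠ g 0 := fun h => by have := inj i 0 (by omega) (by omega) h; omega
          have h5 : g i ≠ g k := fun h => by have := inj i k (by omega) (by omega) h; omega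
          omega
        obtain ⟨l, hl, hf⟩ := runs_surj (k - 1) (fun i => g (i + 1) - 1)
          (by
            intro i hi
            have := hin (i+1) (by omega) (by omega)
            omega)
          (by
            intro i hi
            have h1 := hin (i+1) (by omega) (by omega)
            have h2 := hinv (i + 1) (by omega)
            rw [Nat.sub_add_cancel (by omega), h2]; omega)
          (by
            intro y c d h1 h2 h3 h4 h5
            have := hin (d+1) (by omega) (by omega)
            exact hav 0 (y + 1) (c + 1) (d + 1) (by omega) (by omega) (by omega) (by omega)
              (by omega) (by omega) (by omega))
        refine ⟨some l, by simp only [cSize]; omega, ?_⟩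
        intro i hi
        simp only [cFun]
        split_ifs with h1 h2
        · subst h1; omega
        · have : i = k := by omega
          subst this; omega
        · have h3 := hf (i - 1) (by omega)
          rw [Nat.sub_add_cancel (by omega)] at h3
          have h4 := hin i (by omega) (by omega)
          omega
    obtain ⟨e, he, hef⟩ := hcomp
    have hgt : ∀ i, k < i → i < N → k < g i := by
      intro i hi hiN
      by_contra hcon
      have := hle (g i) (by omega)
      have := hinv i hiN
      omega
    obtain ⟨l, hl, hf⟩ := ih (N - (k+1)) (by omega) (fun i => g (i + (k+1)) - (k+1))
      (by
        intro i hi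
        have := hlt (i + (k+1)) (by omega)
        have := hgt (i + (k+1)) (by omega) (by omega)
        omega)
      (by
        intro i hi
        have h1 := hgt (i + (k+1)) (by omega) (by omega)
        have h2 := hinv (i + (k+1)) (by omega)
        rw [Nat.sub_add_cancel (by omega), h2]; omega)
      (by
        intro x y c d h0 h1 h2 h3 h4 h5 h6
        exact hav (x + (k+1)) (y + (k+1)) (c + (k+1)) (d + (k+1)) (by omega) (by omega) (by omega)
          (by omega) (by omega) (by omega) (by omega))
    refine ⟨e :: l, by simp only [xSize]; omega, ?_⟩
    intro i hi
    simp only [sig, he]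
    split_ifs with h
    · exact hef i h
    · have h1 := hf (i - (k+1)) (by omega)
      rw [Nat.sub_add_cancel (by omega)] at h1
      have h2 := hgt i (by omega) hi
      omega

/-! ### Permutations -/

def pFun {N : ℕ} (π : Equiv.Perm (Fin N)) (i : ℕ) : ℕ :=
  if h : i < N then N - 1 - (π ⟨i, h⟩ : ℕ) else i

theorem pFun_inj {N : ℕ} : Function.Injective (pFun (N := N)) := by
  intro π ρ h
  ext i
  have := congrFun h i
  simp only [pFun, i.2, dif_pos, Fin.eta] at this
  have := (π i).2
  have := (ρ i).2
  omega

theorem avoid_of {N : ℕ} (π : Equiv.Perm (Fin N)) (h1 : Avoids π pat1243) (h2 : Avoids π pat2143)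
    (x y c d : Fin N) (hxy : x < y) (hyc : y < c) (hcd : c < d) (h3 : π d < π c) (h4 : π x < π d)
    (h5 : π y < π d) : False := by
  have hm : StrictMono ![x, y, c, d] := by
    rw [Fin.strictMono_iff_lt_succ]
    intro i
    fin_cases i <;> simpa
  rcases lt_or_ge (π x) (π y) with h | h
  · apply h1
    refine ⟨![x, y, c, d], hm, ?_⟩
    have e0 : pat1243 0 = 0 := by decide
    have e1 : pat1243 1 = 1 := by decide
    have e2 : pat1243 2 = 3 := by decide
    have e3 : pat1243 3 = 2 := by decide
    intro a b
    fin_cases a <;> fin_cases b <;> simp [e0, e1, e2, e3] <;> omega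
  · have h : π y < π x := lt_of_le_of_ne h (by
      intro h; have := π.injective h; omega)
    apply h2
    refine ⟨![x, y, c, d], hm, ?_⟩
    have e0 : pat2143 0 = 1 := by decide
    have e1 : pat2143 1 = 0 := by decide
    have e2 : pat2143 2 = 3 := by decide
    have e3 : pat2143 3 = 2 := by decide
    intro a b
    fin_cases a <;> fin_cases b <;> simp [e0, e1, e2, e3] <;> omega

theorem of_contains {N : ℕ} (π : Equiv.Perm (Fin N))
    (h : Contains π pat1243 ∨ Contains π pat2143) :
    ∃ x y c d : Fin N, x < y ∧ y < c ∧ c < d ∧ π d < π c ∧ π x < π d ∧ π y < π d := by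
  rcases h with ⟨f, hf, h⟩ | ⟨f, hf, h⟩
  · exact ⟨f 0, f 1, f 2, f 3, hf (by decide), hf (by decide), hf (by decide),
      (h 3 2).1 (by decide), (h 0 3).1 (by decide), (h 1 3).1 (by decide)⟩
  · exact ⟨f 0, f 1, f 2, f 3, hf (by decide), hf (by decide), hf (by decide),
      (h 3 2).1 (by decide), (h 0 3).1 (by decide), (h 1 3).1 (by decide)⟩

def XSet (n : ℕ) : Set (List (Option (List ℕ))) := {x | xSize x = n + 1 ∧ xRev x = x}

theorem perm_image (n : ℕ) : pFun '' {π : Equiv.Perm (Fin (n + 1)) |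
    π⁻¹ = π ∧ rc π = π ∧ Avoids π pat1243 ∧ Avoids π pat2143} = sig '' XSet n := by
  ext g
  constructor
  · rintro ⟨π, ⟨hinv, hrc, ha1, ha2⟩, rfl⟩
    have hval : ∀ i (h : i < n + 1), pFun π i = n - (π ⟨i, h⟩ : ℕ) := by
      intro i h; simp [pFun, h]
    have hlt : ∀ i < n + 1, pFun π i < n + 1 := by
      intro i h; rw [hval i h]; omega
    have hpp : ∀ i, π (π i) = i := by
      intro i
      conv_lhs => rw [← hinv]
      rw [hinv]
      nth_rewrite 1 [← hinv]
      simp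
    have hsym : ∀ i (h : i < n + 1), (π ⟨n - i, by omega⟩ : ℕ) = n - π ⟨i, h⟩ := by
      intro i h
      have := congrArg (fun ρ : Equiv.Perm (Fin (n+1)) => (ρ ⟨n - i, by omega⟩ : ℕ)) hrc
      simp only [rc, Equiv.trans_apply, Fin.revPerm_apply, Fin.val_rev] at this
      have e : Fin.rev (⟨n - i, by omega⟩ : Fin (n+1)) = ⟨i, h⟩ := by
        ext; simp [Fin.val_rev]; omega
      rw [e] at this
      omega
    have hii : ∀ i < n + 1, pFun π (pFun π i) = i := by
      intro i h
      have h1 := hval i h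
      have h2 := (π ⟨i, h⟩).2
      rw [hval _ (hlt i h)]
      simp only [h1]
      rw [hsym _ h2]
      simp only [Fin.eta, hpp]
      omega
    obtain ⟨x, hx, hf⟩ := sig_surj (n+1) (pFun π) hlt hii (by
      intro x y c d h0 h1 h2 h3 h4 h5 h6
      rw [hval c (by omega), hval d (by omega)] at h4
      rw [hval d (by omega), hval x (by omega)] at h5
      rw [hval d (by omega), hval y (by omega)] at h6
      refine avoid_of π ha1 ha2 ⟨x, by omega⟩ ⟨y, by omega⟩ ⟨c, by omega⟩ ⟨d, by omega⟩ h0 h1 h2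
        ?_ ?_ ?_ <;> (rw [Fin.lt_def]; omega))
    refine ⟨x, ⟨hx, ?_⟩, ?_⟩
    · apply sig_inj _ _ (xSize_rev x)
      intro i hi
      rw [xSize_rev, hx] at hi
      rw [sig_rev x i (by omega), hx, Nat.add_sub_cancel, ← hf _ (by omega), ← hf _ hi,
        hval _ (by omega), hval i hi, hsym i hi]
      have := (π ⟨i, hi⟩).2
      omega
    · funext i
      by_cases hi : i < n + 1
      · exact (hf i hi).symm
      · rw [sig_ge x i (by omega)]; simp [pFun, hi]
  · rintro ⟨x, ⟨hx, hr⟩, rfl⟩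
    have hlt : ∀ i < n + 1, sig x i < n + 1 := by
      intro i hi; rw [← hx] at hi ⊢; exact sig_lt x i hi
    have hinv : ∀ i < n + 1, sig x (sig x i) = i := by
      intro i hi; rw [← hx] at hi; exact sig_invol x i hi
    have hsym : ∀ i < n + 1, sig x i = n - sig x (n - i) := by
      intro i hi
      have := sig_rev x i (by omega)
      rw [hr, hx, Nat.add_sub_cancel] at this
      exact this
    let F : Fin (n+1) → Fin (n+1) := fun i => ⟨n - sig x i, by omega⟩
    have hF : Function.Involutive F := by
      intro i
      ext
      have h1 := hsym (sig x i) (hlt i i.2)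
      rw [hinv i i.2] at h1
      simp only [F]
      omega
    have hFv : ∀ i, (F i : ℕ) = n - sig x i := fun i => rfl
    have hno : ¬ (Contains hF.toPerm pat1243 ∨ Contains hF.toPerm pat2143) := by
      intro h
      obtain ⟨a, b, c, d, h0, h1, h2, h3, h4, h5⟩ := of_contains _ h
      simp only [Function.Involutive.coe_toPerm, Fin.lt_def, hFv] at h0 h1 h2 h3 h4 h5
      have := hlt a a.2
      have := hlt b b.2
      have := hlt c c.2
      have := hlt d d.2
      exact sig_avoid x a b c d h0 h1 h2 (by omega) (by omega) (by omega) (by omega)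
    refine ⟨hF.toPerm, ⟨?_, ?_, fun h => hno (Or.inl h), fun h => hno (Or.inr h)⟩, ?_⟩
    · exact hF.toPerm_symm
    · ext i
      have h1 := hsym i i.2
      have h2 := hlt i i.2
      have e : ((Fin.rev i : Fin (n+1)) : ℕ) = n - i := by rw [Fin.val_rev]; omega
      simp only [rc, Equiv.trans_apply, Fin.revPerm_apply, Function.Involutive.coe_toPerm,
        Fin.val_rev (F _), hFv, e]
      have := hlt (n - i) (by omega)
      omega
    · funext i
      by_cases hi : i < n + 1
      · have := hlt i hi
        simp only [pFun, hi, dif_pos, Function.Involutive.coe_toPerm, hFv]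
        omega
      · rw [sig_ge x i (by omega)]; simp [pFun, hi]

theorem sig_injOn (n : ℕ) : Set.InjOn sig (XSet n) := by
  intro x hx y hy h
  exact sig_inj x y (hx.1.trans hy.1.symm) (fun i _ => by rw [h])


/-! ### Paths -/

def rPath : List ℕ → List Step
  | [] => []
  | k :: l => List.replicate (k + 1) Step.N ++ List.replicate (k + 1) Step.E ++ rPath l

def cPath : Option (List ℕ) → List Step
  | none => []
  | some l => Step.N :: (rPath l ++ [Step.E])

def tl : List (Option (List ℕ)) → List Step
  | [] => []
  | c :: x => Step.D :: (cPath c ++ tl x)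

def trl : List (Option (List ℕ)) → List Step
  | [] => []
  | c :: x => cPath c ++ Step.D :: trl x

theorem rPath_append (l m : List ℕ) : rPath (l ++ m) = rPath l ++ rPath m := by
  induction l with
  | nil => simp [rPath]
  | cons k l ih => simp [rPath, ih]

theorem trl_append (l m) : trl (l ++ m) = trl l ++ trl m := by
  induction l with
  | nil => simp [trl]
  | cons k l ih => simp [trl, ih]

theorem cons_trl (x) : Step.D :: trl x = tl x ++ [Step.D] := by
  induction x with
  | nil => simp [trl, tl]
  | cons c x ih => simp [trl, tl, ih]

theorem revPath_append (p q) : revPath (p ++ q) = revPath q ++ revPath p := by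
  simp [revPath]

theorem revPath_rPath (l : List ℕ) : revPath (rPath l) = rPath l.reverse := by
  induction l with
  | nil => simp [rPath, revPath]
  | cons k l ih =>
    have h1 : revPath (List.replicate (k+1) Step.N) = List.replicate (k+1) Step.E := by
      simp only [revPath, List.reverse_replicate, List.map_replicate, revStep]
    have h2 : revPath (List.replicate (k+1) Step.E) = List.replicate (k+1) Step.N := by
      simp only [revPath, List.reverse_replicate, List.map_replicate, revStep]
    rw [List.reverse_cons, rPath_append, ← ih]
    simp only [rPath, revPath_append, h1, h2, List.append_nil]

theorem revPath_cPath (c) : revPath (cPath c) = cPath (cRev c) := by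
  cases c with
  | none => rfl
  | some l =>
    simp only [cPath, cRev, ← revPath_rPath]
    simp [revPath, revStep]

theorem revPath_tl (x) : revPath (tl x) = trl (xRev x) := by
  induction x with
  | nil => rfl
  | cons c x ih =>
    rw [xRev_cons, trl_append, ← ih]
    have : tl (c :: x) = [Step.D] ++ (cPath c ++ tl x) := rfl
    rw [this, revPath_append, revPath_append, revPath_cPath, List.append_assoc]
    rfl

theorem rev_of_tl (x p) (h : Step.D :: p = tl x) : Step.D :: revPath p = tl (xRev x) := by
  have h1 : revPath (Step.D :: p) = revPath p ++ [Step.D] := by simp [revPath, revStep]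
  have h2 := cons_trl (xRev x)
  rw [← revPath_tl, ← h, h1] at h2
  exact List.append_cancel_right (as := Step.D :: revPath p) h2

theorem replN_inj : ∀ (a b : ℕ) (u v : List Step),
    List.replicate a Step.N ++ Step.E :: u = List.replicate b Step.N ++ Step.E :: v →
    a = b ∧ u = v := by
  intro a
  induction a with
  | zero =>
    intro b u v h
    cases b with
    | zero => simpa using h
    | succ b => simp [List.replicate_succ] at h
  | succ a ih =>
    intro b u v h
    cases b with
    | zero => simp [List.replicate_succ] at h
    | succ b =>
      simp only [List.replicate_succ, List.cons_append, List.cons.injEq, true_and] at h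
      obtain ⟨h1, h2⟩ := ih b u v h
      exact ⟨by omega, h2⟩

theorem rPath_inj (l : List ℕ) : ∀ m r s, rPath l ++ Step.E :: r = rPath m ++ Step.E :: s →
    l = m ∧ r = s := by
  induction l with
  | nil =>
    intro m r s h
    cases m with
    | nil => simpa [rPath] using h
    | cons k m => simp [rPath, List.replicate_succ] at h
  | cons k l ih =>
    intro m r s h
    cases m with
    | nil => simp [rPath, List.replicate_succ] at h
    | cons k' m =>
      simp only [rPath, List.append_assoc] at h
      rw [List.replicate_succ (a := Step.E), List.replicate_succ (a := Step.E), List.cons_append,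
        List.cons_append] at h
      obtain ⟨h1, h2⟩ := replN_inj _ _ _ _ h
      have h1 : k = k' := by omega
      subst h1
      have h3 := List.append_cancel_left h2
      obtain ⟨h4, h5⟩ := ih m r s h3
      exact ⟨by rw [h4], h5⟩

theorem tl_inj : ∀ x y, tl x = tl y → x = y := by
  intro x
  induction x with
  | nil =>
    intro y h
    cases y with
    | nil => rfl
    | cons c y => simp [tl] at h
  | cons c x ih =>
    intro y h
    cases y with
    | nil => simp [tl] at h
    | cons c' y =>
      simp only [tl, List.cons.injEq, true_and] at h
      cases c with
      | none =>
        cases c' with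
        | none => rw [ih y h]
        | some l' => cases x <;> simp [cPath, tl] at h
      | some l =>
        cases c' with
        | none => cases y <;> simp [cPath, tl] at h
        | some l' =>
          simp only [cPath, List.cons_append, List.append_assoc, List.cons.injEq, true_and,
            List.nil_append] at h
          obtain ⟨h1, h2⟩ := rPath_inj _ _ _ _ h
          rw [h1, ih y h2]

/-! positions -/

theorem posX_append (p q) : posX (p ++ q) = posX p + posX q := by
  simp [posX]; omega

theorem posY_append (p q) : posY (p ++ q) = posY p + posY q := by
  simp [posY]; omega

theorem posX_E (p) : posX (Step.E :: p) = posX p + 1 := by simp [posX]; omega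
theorem posX_N (p) : posX (Step.N :: p) = posX p := by simp [posX]
theorem posX_D (p) : posX (Step.D :: p) = posX p + 1 := by simp [posX]; omega
theorem posY_E (p) : posY (Step.E :: p) = posY p := by simp [posY]
theorem posY_N (p) : posY (Step.N :: p) = posY p + 1 := by simp [posY]; omega
theorem posY_D (p) : posY (Step.D :: p) = posY p + 1 := by simp [posY]; omega
theorem posX_nil : posX [] = 0 := rfl
theorem posY_nil : posY [] = 0 := rfl

theorem posX_rN (k) : posX (List.replicate k Step.N) = 0 := by
  induction k with
  | zero => rfl
  | succ k ih => rw [List.replicate_succ, posX_N, ih]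
theorem posX_rE (k) : posX (List.replicate k Step.E) = k := by
  induction k with
  | zero => rfl
  | succ k ih => rw [List.replicate_succ, posX_E, ih]
theorem posY_rN (k) : posY (List.replicate k Step.N) = k := by
  induction k with
  | zero => rfl
  | succ k ih => rw [List.replicate_succ, posY_N, ih]
theorem posY_rE (k) : posY (List.replicate k Step.E) = 0 := by
  induction k with
  | zero => rfl
  | succ k ih => rw [List.replicate_succ, posY_E, ih]

theorem inner_bal {q} (h : IsInnerWord q) : posX q = posY q := by
  induction h with
  | nil => rfl
  | dcons _ ih => rw [posX_D, posY_D, ih]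
  | peak _ _ ih => simp only [posX_append, posY_append, posX_rN, posX_rE, posY_rN, posY_rE]; omega

theorem dword_bal {p} (h : IsDWord p) : posX p = posY p := by
  induction h with
  | nil => rfl
  | dcons _ ih => rw [posX_D, posY_D, ih]
  | block hq _ ih =>
    have := inner_bal hq
    simp only [posX_append, posY_append, posX_N, posY_N, posX_E, posY_E]; omega

/-! Schröder condition, with starting height -/

def SP : ℕ → List Step → Prop
  | _, [] => True
  | h, Step.N :: p => SP (h + 1) p
  | h, Step.D :: p => SP h p
  | h, Step.E :: p => 1 ≤ h ∧ SP (h - 1) p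

theorem SP_prefix (p : List Step) : ∀ h, SP h p → ∀ q, q <+: p → posX q ≤ posY q + h := by
  induction p with
  | nil => intro h _ q hq; rw [List.prefix_nil] at hq; subst hq; simp [posX_nil]
  | cons a p ih =>
    intro h hs q hq
    rw [List.prefix_cons_iff] at hq
    rcases hq with rfl | ⟨t, rfl, ht⟩
    · simp [posX_nil]
    · cases a with
      | N => have := ih _ hs t ht; rw [posX_N, posY_N]; omega
      | D => have := ih _ hs t ht; rw [posX_D, posY_D]; omega
      | E => have := ih _ hs.2 t ht; have := hs.1; rw [posX_E, posY_E]; omega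

theorem SP_rN (k) : ∀ h p, SP (h + k) p → SP h (List.replicate k Step.N ++ p) := by
  induction k with
  | zero => intro h p hp; simpa using hp
  | succ k ih =>
    intro h p hp
    rw [List.replicate_succ, List.cons_append]
    exact ih (h+1) p (by rwa [show h + 1 + k = h + (k + 1) by omega])

theorem SP_rE (k) : ∀ h p, SP h p → SP (h + k) (List.replicate k Step.E ++ p) := by
  induction k with
  | zero => intro h p hp; simpa using hp
  | succ k ih =>
    intro h p hp
    rw [List.replicate_succ, List.cons_append]
    exact ⟨by omega, ih h p hp⟩

theorem SP_inner {q} (hq : IsInnerWord q) : ∀ h p, SP h p → SP h (q ++ p) := by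
  induction hq with
  | nil => intro h p hp; exact hp
  | dcons _ ih => intro h p hp; exact ih h p hp
  | peak _ _ ih =>
    intro h p hp
    rw [List.append_assoc, List.append_assoc]
    exact SP_rN _ _ _ (SP_rE _ _ _ (ih h p hp))

theorem SP_dword {p} (hp : IsDWord p) : SP 0 p := by
  induction hp with
  | nil => trivial
  | dcons _ ih => exact ih
  | block hq _ ih => exact SP_inner hq 1 _ ⟨le_refl _, ih⟩

theorem memD_iff (n p) : MemD n p ↔ IsDWord p ∧ posX p = n := by
  constructor
  · rintro ⟨h1, h2⟩; exact ⟨h1, h2.2.1⟩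
  · rintro ⟨h1, h2⟩
    refine ⟨h1, fun q hq => ?_, h2, ?_⟩
    · simpa using SP_prefix p 0 (SP_dword h1) q hq
    · rw [← dword_bal h1, h2]

/-! Features, with starting height -/

def FL (h : ℤ) (p : List Step) : Prop :=
  ∀ q r, ((p = q ++ Step.D :: r ∨ p = q ++ Step.E :: Step.N :: r) →
    (posY q : ℤ) + h ≠ posX q + 1)

theorem featureless_iff (p) : Featureless p ↔ FL 0 p := by
  constructor
  · rintro h q r hp he
    have he' : posY q = posX q + 1 := by omega
    rcases hp with hp | hp
    · exact (h (posY q)).1 ⟨by omega, q, r, hp, by omega, rfl⟩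
    · exact (h (posY q)).2 ⟨by omega, q, r, hp, by omega, rfl⟩
  · intro h t
    constructor
    · rintro ⟨ht, q, r, hp, h1, h2⟩
      exact h q r (Or.inl hp) (by omega)
    · rintro ⟨ht, q, r, hp, h1, h2⟩
      exact h q r (Or.inr hp) (by omega)

theorem FL_nil (h) : FL h [] := by
  intro q r hp; simp at hp

theorem FL_N (h p) : FL h (Step.N :: p) ↔ FL (h + 1) p := by
  constructor
  · intro hf q r hp he
    apply hf (Step.N :: q) r (by simpa using hp)
    rw [posY_N, posX_N]; push_cast; omega
  · intro hf q r hp he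
    cases q with
    | nil => simp at hp
    | cons a q =>
      have ha : a = Step.N := by rcases hp with hp | hp <;> simp_all
      subst ha
      apply hf q r (by simpa using hp)
      rw [posY_N, posX_N] at he; push_cast at he; omega

theorem FL_D (h p) : FL h (Step.D :: p) ↔ h ≠ 1 ∧ FL h p := by
  constructor
  · intro hf
    refine ⟨fun h1 => hf [] p (by simp) (by simp [posX_nil, posY_nil, h1]), ?_⟩
    intro q r hp he
    apply hf (Step.D :: q) r (by simpa using hp)
    rw [posY_D, posX_D]; push_cast; omega
  · rintro ⟨h1, hf⟩ q r hp he
    cases q with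
    | nil => simp [posX_nil, posY_nil] at he; exact h1 he
    | cons a q =>
      have ha : a = Step.D := by rcases hp with hp | hp <;> simp_all
      subst ha
      apply hf q r (by simpa using hp)
      rw [posY_D, posX_D] at he; push_cast at he; omega

theorem FL_E (h p) : FL h (Step.E :: p) ↔ (h = 1 → ∀ r, p ≠ Step.N :: r) ∧ FL (h - 1) p := by
  constructor
  · intro hf
    refine ⟨fun h1 r hr => hf [] r (by simp [hr]) (by simp [posX_nil, posY_nil, h1]), ?_⟩
    intro q r hp he
    apply hf (Step.E :: q) r (by simpa using hp)
    rw [posY_E, posX_E]; push_cast; omega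
  · rintro ⟨h1, hf⟩ q r hp he
    cases q with
    | nil =>
      simp [posX_nil, posY_nil] at he
      simp at hp
      exact h1 he r hp
    | cons a q =>
      have ha : a = Step.E := by rcases hp with hp | hp <;> simp_all
      subst ha
      apply hf q r (by simpa using hp)
      rw [posY_E, posX_E] at he; push_cast at he; omega

theorem FL_rN (k : ℕ) : ∀ (h : ℤ) p, FL h (List.replicate k Step.N ++ p) ↔ FL (h + k) p := by
  induction k with
  | zero => intro h p; simp
  | succ k ih =>
    intro h p
    rw [List.replicate_succ, List.cons_append, FL_N, ih,
      show h + 1 + (k : ℤ) = h + ((k + 1 : ℕ) : ℤ) by push_cast; ring]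

theorem FL_rE (k : ℕ) : ∀ (h : ℤ) p, 1 ≤ h → (FL (h + k) (List.replicate k Step.E ++ p) ↔ FL h p) := by
  induction k with
  | zero => intro h p _; simp
  | succ k ih =>
    intro h p hh
    rw [List.replicate_succ, List.cons_append, FL_E,
      show h + ((k + 1 : ℕ) : ℤ) - 1 = h + k by push_cast; ring, ih h p hh]
    constructor
    · exact fun h => h.2
    · intro hf
      refine ⟨fun h1 => ?_, hf⟩
      push_cast at h1; omega

theorem FL_rPath (l : List ℕ) (p) : FL 1 (rPath l ++ p) ↔ FL 1 p := by
  induction l with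
  | nil => simp [rPath]
  | cons k l ih =>
    simp only [rPath, List.append_assoc]
    rw [FL_rN, FL_rE _ _ _ (le_refl _), ih]

theorem inner_FL {q} (hq : IsInnerWord q) : ∀ p, FL 1 (q ++ p) → ∃ l, q = rPath l := by
  induction hq with
  | nil => intro p _; exact ⟨[], rfl⟩
  | dcons _ ih => intro p hp; rw [List.cons_append, FL_D] at hp; exact absurd rfl hp.1
  | @peak k q hk _ ih =>
    intro p hp
    rw [List.append_assoc, List.append_assoc, FL_rN, FL_rE _ _ _ (le_refl _)] at hp
    obtain ⟨l, rfl⟩ := ih p hp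
    refine ⟨(k - 1) :: l, ?_⟩
    simp only [rPath]
    rw [Nat.sub_add_cancel hk]

theorem inner_rPath (l : List ℕ) : IsInnerWord (rPath l) := by
  induction l with
  | nil => exact IsInnerWord.nil
  | cons k l ih => exact IsInnerWord.peak (Nat.succ_pos k) ih

theorem dword_cPath (c p) (hp : IsDWord p) : IsDWord (cPath c ++ p) := by
  cases c with
  | none => exact hp
  | some l =>
    have := IsDWord.block (inner_rPath l) hp
    simpa [cPath] using this

theorem dword_tl (x) : IsDWord (tl x) := by
  induction x with
  | nil => exact IsDWord.nil
  | cons c x ih => exact IsDWord.dcons (dword_cPath c _ ih)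

theorem tl_not_N (x r) : tl x ≠ Step.N :: r := by
  cases x <;> simp [tl]

theorem FL_tl (x) : FL 0 (tl x) := by
  induction x with
  | nil => exact FL_nil 0
  | cons c x ih =>
    simp only [tl]
    rw [FL_D]
    refine ⟨by norm_num, ?_⟩
    cases c with
    | none => exact ih
    | some l =>
      simp only [cPath, List.cons_append, List.append_assoc, List.nil_append]
      rw [FL_N, zero_add, FL_rPath, FL_E]
      exact ⟨fun _ r => tl_not_N x r, by simpa using ih⟩

theorem dword_surj {p} (hp : IsDWord p) : FL 0 p → ∃ x, Step.D :: p = tl x := by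
  induction hp with
  | nil => intro _; exact ⟨[none], rfl⟩
  | dcons _ ih =>
    intro hf
    rw [FL_D] at hf
    obtain ⟨x, hx⟩ := ih hf.2
    exact ⟨none :: x, by rw [hx]; rfl⟩
  | @block q p hq _ ih =>
    intro hf
    rw [FL_N, zero_add] at hf
    obtain ⟨l, rfl⟩ := inner_FL hq _ hf
    rw [FL_rPath, FL_E] at hf
    obtain ⟨x, hx⟩ := ih (by simpa using hf.2)
    cases x with
    | nil => simp [tl] at hx
    | cons c x =>
      cases c with
      | none =>
        refine ⟨some l :: x, ?_⟩
        simp [tl, cPath] at hx ⊢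
        exact hx
      | some m =>
        simp only [tl, cPath, List.cons.injEq, true_and, List.cons_append] at hx
        exact absurd hx (hf.1 rfl _)

theorem posX_rPath (l : List ℕ) : posX (rPath l) = rSize l := by
  induction l with
  | nil => rfl
  | cons k l ih => simp only [rPath, posX_append, posX_rN, posX_rE, ih, rSize]; omega

theorem posX_tl (x) : posX (tl x) = xSize x := by
  induction x with
  | nil => rfl
  | cons c x ih =>
    simp only [tl, posX_D, posX_append, xSize, ih]
    cases c with
    | none => simp [cPath, posX_nil, cSize]; omega
    | some l => simp only [cPath, posX_N, posX_append, posX_rPath, posX_E, posX_nil, cSize]; omega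

theorem path_image (n : ℕ) : (fun p => Step.D :: p) ''
    {p : List Step | MemD n p ∧ revPath p = p ∧ Featureless p} = tl '' XSet n := by
  ext w
  constructor
  · rintro ⟨p, ⟨hD, hr, hf⟩, rfl⟩
    rw [memD_iff] at hD
    rw [featureless_iff] at hf
    obtain ⟨x, hx⟩ := dword_surj hD.1 hf
    refine ⟨x, ⟨?_, ?_⟩, hx.symm⟩
    · rw [← posX_tl, ← hx, posX_D, hD.2]
    · apply tl_inj
      rw [← rev_of_tl x p hx, hr, hx]
  · rintro ⟨x, ⟨hs, hr⟩, rfl⟩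
    cases x with
    | nil => simp [xSize] at hs
    | cons c x =>
      refine ⟨cPath c ++ tl x, ⟨?_, ?_, ?_⟩, rfl⟩
      · rw [memD_iff]
        refine ⟨dword_cPath c _ (dword_tl x), ?_⟩
        have := posX_tl (c :: x)
        simp only [tl, posX_D] at this
        omega
      · have := rev_of_tl (c :: x) _ rfl
        rw [hr] at this
        simpa [tl] using this
      · rw [featureless_iff]
        have := FL_tl (c :: x)
        simp only [tl] at this
        rw [FL_D] at this
        exact this.2

theorem stmt_6 :
    ∀ n : ℕ,
      Set.ncard {π : Equiv.Perm (Fin (n + 1)) |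
          π⁻¹ = π ∧ rc π = π ∧ Avoids π pat1243 ∧ Avoids π pat2143} =
        Set.ncard {p : List Step | MemD n p ∧ revPath p = p ∧ Featureless p} := by
  intro n
  rw [← Set.ncard_image_of_injective _ (pFun_inj (N := n + 1)), perm_image,
    Set.ncard_image_of_injOn (sig_injOn n),
    ← Set.ncard_image_of_injective (f := fun p : List Step => Step.D :: p) _
      (fun a b h => by simpa using h), path_image,
    Set.ncard_image_of_injective _ (fun x y h => tl_inj x y h)]
end

section
/- For every n ≥ 1, the number of Schröder paths p ∈ D_{2n} satisfying rev(ψ(p)) = p equals 2 b_n − b_{n−1}, where b_i is the number of Schröder prefixes in 𝒟 terminating at (i−1,i). -/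
namespace Schr

inductive Tok : Type
  | d0 : Tok
  | up : Tok
  | down : Tok
  | lev : Tok
  | notch : Tok
  | peak (k : ℕ) : Tok

open Tok

def st : Tok → ℕ
  | d0 => 0
  | up => 0
  | _ => 1

def en : Tok → ℕ
  | d0 => 0
  | down => 0
  | _ => 1

def wt : Tok → ℕ
  | d0 => 2
  | up => 1
  | down => 1
  | lev => 2
  | notch => 2
  | peak k => 2 * (k + 1)

def tk : Tok → List Step
  | d0 => [Step.D]
  | up => [Step.N]
  | down => [Step.E]
  | lev => [Step.D]
  | notch => [Step.E, Step.N]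
  | peak k => List.replicate (k+1) Step.N ++ List.replicate (k+1) Step.E

def tau : Tok → Tok
  | lev => notch
  | notch => lev
  | t => t

def rho : Tok → Tok
  | up => down
  | down => up
  | t => t

def sg (t : Tok) : Tok := rho (tau t)

def R (a b : Tok) : Prop := en a = st b ∧ ¬ (a = down ∧ b = up)

def flat (L : List Tok) : List Step := L.flatMap tk

def w (L : List Tok) : ℕ := (L.map wt).sum

def WF (a : Tok) (L : List Tok) (b : Tok) : Prop := List.IsChain R (a :: (L ++ [b]))

def sig (L : List Tok) : List Tok := (L.map sg).reverse

@[simp] theorem flat_nil : flat [] = [] := rfl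
@[simp] theorem flat_cons (t L) : flat (t :: L) = tk t ++ flat L := rfl
@[simp] theorem flat_append (L M) : flat (L ++ M) = flat L ++ flat M := by simp [flat]
@[simp] theorem w_nil : w [] = 0 := rfl
@[simp] theorem w_cons (t L) : w (t :: L) = wt t + w L := rfl
@[simp] theorem w_append (L M) : w (L ++ M) = w L + w M := by simp [w]

@[simp] theorem WF_nil (a b) : WF a [] b ↔ R a b := by simp [WF]
@[simp] theorem WF_cons (a t L b) : WF a (t :: L) b ↔ R a t ∧ WF t L b := by simp [WF]
theorem WF_append (a L t M b) : WF a (L ++ t :: M) b ↔ WF a L t ∧ WF t M b := by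
  induction L generalizing a with
  | nil => simp
  | cons c L ih => simp [ih, and_assoc]
@[simp] theorem WF_concat (a L t b) : WF a (L ++ [t]) b ↔ WF a L t ∧ R t b := by
  simp [WF_append]

theorem WF_last {a L b c} (h : WF a L b) (hs : st b = st c) (hc : c ≠ up) : WF a L c := by
  induction L generalizing a with
  | nil => simp [R] at h ⊢; exact ⟨by omega, fun _ => hc⟩
  | cons t L ih => simp at h ⊢; exact ⟨h.1, ih h.2⟩

theorem sg_sg (t) : sg (sg t) = t := by cases t <;> rfl
theorem wt_sg (t) : wt (sg t) = wt t := by cases t <;> rfl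
theorem R_sg (a b) : R (sg b) (sg a) ↔ R a b := by
  cases a <;> cases b <;> simp [R, sg, tau, rho, st, en]
theorem R_tau (a b) : R (tau a) (tau b) ↔ R a b := by
  cases a <;> cases b <;> simp [R, tau, st, en]

@[simp] theorem sig_nil : sig [] = [] := rfl
@[simp] theorem sig_cons (t L) : sig (t :: L) = sig L ++ [sg t] := by simp [sig]
@[simp] theorem sig_append (L M) : sig (L ++ M) = sig M ++ sig L := by simp [sig]
@[simp] theorem sig_sig (L) : sig (sig L) = L := by
  induction L with
  | nil => rfl
  | cons t L ih => simp [ih, sg_sg]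
@[simp] theorem w_sig (L) : w (sig L) = w L := by
  induction L with
  | nil => rfl
  | cons t L ih => simp [ih, wt_sg]; omega
@[simp] theorem length_sig (L) : (sig L).length = L.length := by simp [sig]

theorem WF_sig (a L b) : WF (sg b) (sig L) (sg a) ↔ WF a L b := by
  induction L generalizing a with
  | nil => simp [R_sg]
  | cons t L ih => simp [ih, R_sg]; tauto

theorem WF_tau (a L b) : WF (tau a) (L.map tau) (tau b) ↔ WF a L b := by
  induction L generalizing a with
  | nil => simp [R_tau]
  | cons t L ih => simp [ih, R_tau]

/-! positions -/

@[simp] theorem posX_append (p q) : posX (p ++ q) = posX p + posX q := by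
  simp [posX]; omega
@[simp] theorem posY_append (p q) : posY (p ++ q) = posY p + posY q := by
  simp [posY]; omega

theorem pos_tk (t) : posX (tk t) + posY (tk t) = wt t ∧ posY (tk t) + st t = posX (tk t) + en t := by
  cases t <;> simp [tk, posX, posY, wt, st, en, List.count_replicate] <;> omega

theorem pos_flat {a L b} (h : WF a L b) :
    posX (flat L) + posY (flat L) = w L ∧ posY (flat L) + en a = posX (flat L) + st b := by
  induction L generalizing a with
  | nil => simp [R] at h; simp [posX, posY, h.1]
  | cons t L ih =>
    simp at h
    have := ih h.2
    have h2 := pos_tk t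
    have h3 := h.1.1
    simp; omega

theorem tk_ne (t) : tk t ≠ [] := by cases t <;> simp [tk, List.replicate_succ]

/-! injectivity -/

theorem rep_inj {k k' : ℕ} {l l' : List Step}
    (h : List.replicate k Step.N ++ Step.E :: l = List.replicate k' Step.N ++ Step.E :: l') :
    k = k' ∧ l = l' := by
  induction k generalizing k' with
  | zero =>
    cases k' with
    | zero => simpa using h
    | succ k' => simp [List.replicate_succ] at h
  | succ k ih =>
    cases k' with
    | zero => simp [List.replicate_succ] at h
    | succ k' =>
      simp [List.replicate_succ] at h
      have := ih h
      simp [this]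

theorem after_down {L} (h : WF down L d0) : L = [] ∨ ∃ L', L = d0 :: L' := by
  cases L with
  | nil => simp
  | cons t L => cases t <;> simp [R, en, st] at h ⊢

theorem flat_inj {a a' L L'} (h : WF a L d0) (h' : WF a' L' d0) (ha : en a = en a')
    (hf : flat L = flat L') : L = L' := by
  induction L generalizing a a' L' with
  | nil =>
    cases L' with
    | nil => rfl
    | cons t L => simp [tk_ne] at hf
  | cons t L ih =>
    cases L' with
    | nil => simp [tk_ne] at hf
    | cons t' L' =>
      simp only [WF_cons] at h h'
      have hs : st t = st t' := by have := h.1.1; have := h'.1.1; omega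
      cases t <;> cases t' <;> simp [st] at hs <;>
        simp [tk, List.replicate_succ] at hf
      · rw [ih h.2 h'.2 rfl hf]
      · rw [ih h.2 h'.2 rfl hf]
      · rw [ih h.2 h'.2 rfl hf]
      · rcases after_down h.2 with rfl | ⟨L', rfl⟩ <;> simp [tk] at hf
      · rw [ih h.2 h'.2 rfl hf]
      · rcases after_down h'.2 with rfl | ⟨L', rfl⟩ <;> simp [tk] at hf
      · rw [ih h.2 h'.2 rfl hf]
      · have := rep_inj hf
        obtain ⟨rfl, h3⟩ := this
        simp at h3
        rw [ih h.2 h'.2 rfl h3]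

/-! psi and rev -/

theorem psi_N (h l) : psiAux h (Step.N :: l) = Step.N :: psiAux (h+1) l := by
  rcases h with _ | _ | h <;> simp [psiAux]

theorem psi_Ns (k h l) : psiAux h (List.replicate k Step.N ++ l) =
    List.replicate k Step.N ++ psiAux (h+k) l := by
  induction k generalizing h with
  | zero => simp
  | succ k ih => simp [List.replicate_succ, psi_N, ih]; congr 1; omega

theorem psi_E (h l) : psiAux (h+2) (Step.E :: l) = Step.E :: psiAux (h+1) l := by
  simp [psiAux]

theorem psi_Es (k l) : psiAux (1+k) (List.replicate k Step.E ++ l) =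
    List.replicate k Step.E ++ psiAux 1 l := by
  induction k with
  | zero => simp
  | succ k ih =>
    rw [show 1 + (k+1) = k + 2 by omega]
    simp [List.replicate_succ, psi_E]; rw [add_comm k 1, ih]

theorem psi_flat {a L} (h : WF a L d0) : psiAux (en a) (flat L) = flat (L.map tau) := by
  induction L generalizing a with
  | nil => simp [psiAux]
  | cons t L ih =>
    simp at h
    have ih' := ih h.2
    have h1 := h.1.1
    rw [h1]
    cases t
    · simpa [st, tk, tau, psiAux, en] using ih'
    · simpa [st, tk, tau, psi_N, en] using ih'
    · rcases after_down h.2 with rfl | ⟨L', rfl⟩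
      · simp [st, tk, tau, psiAux]
      · simpa [st, tk, tau, psiAux, en] using ih'
    · simpa [st, tk, tau, psiAux, en] using ih'
    · simpa [st, tk, tau, psiAux, en] using ih'
    · simp only [flat_cons, st, tk, tau, List.append_assoc, psi_Ns, psi_Es, List.map_cons]
      simpa [en] using ih'

theorem rev_append (p q) : revPath (p ++ q) = revPath q ++ revPath p := by simp [revPath]

theorem rev_tk (t) : revPath (tk t) = tk (rho t) := by
  cases t <;> simp [revPath, tk, rho, revStep]

theorem rev_flat (L) : revPath (flat L) = flat (L.map rho).reverse := by
  induction L with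
  | nil => rfl
  | cons t L ih => simp [rev_append, ih, rev_tk]

theorem revpsi {L} (h : WF d0 L d0) : revPath (psi (flat L)) = flat (sig L) := by
  have := psi_flat h
  simp only [en] at this
  rw [psi, this, rev_flat]
  congr 2
  simp [sig, sg, Function.comp_def]

/-! D words -/

theorem inner_tok {q} (h : IsInnerWord q) : ∃ L, flat L = q ∧
    ∀ a t M, en a = 1 → st t = 1 → WF t M d0 → WF a (L ++ t :: M) d0 := by
  induction h with
  | nil =>
    refine ⟨[], rfl, fun a t M ha ht h => ?_⟩
    simp [h, R, ha, ht]; rintro rfl rfl; simp [st] at ht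
  | dcons _ ih =>
    obtain ⟨L, rfl, h⟩ := ih
    refine ⟨lev :: L, rfl, fun a t M ha ht h' => ?_⟩
    simp [h lev t M rfl ht h', R, ha, st]
  | @peak k p hk _ ih =>
    obtain ⟨L, rfl, h⟩ := ih
    refine ⟨peak (k-1) :: L, ?_, fun a t M ha ht h' => ?_⟩
    · simp [tk, Nat.sub_add_cancel hk]
    · simp [h (peak (k-1)) t M rfl ht h', R, ha, st]

theorem dword_tok {p} (h : IsDWord p) : ∃ L, WF d0 L d0 ∧ flat L = p := by
  induction h with
  | nil => exact ⟨[], by simp [R, en, st], rfl⟩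
  | dcons _ ih =>
    obtain ⟨L, h, rfl⟩ := ih
    exact ⟨d0 :: L, by simp [h, R, en, st], rfl⟩
  | @block q p hq _ ih =>
    obtain ⟨L, h, rfl⟩ := ih
    obtain ⟨Q, rfl, hQ⟩ := inner_tok hq
    by_cases hu : ∃ L', L = up :: L'
    · obtain ⟨L', rfl⟩ := hu
      refine ⟨up :: (Q ++ notch :: L'), ?_, by simp [tk]⟩
      simp at h
      rw [WF_cons]
      refine ⟨by simp [R, en, st], hQ _ _ _ rfl rfl ?_⟩
      cases L' with
      | nil => simp [R, en, st] at h
      | cons t L' => simp [R, en] at h ⊢; exact h.2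
    · refine ⟨up :: (Q ++ down :: L), ?_, by simp [tk]⟩
      rw [WF_cons]
      refine ⟨by simp [R, en, st], hQ _ _ _ rfl rfl ?_⟩
      cases L with
      | nil => simp [R, en, st]
      | cons t L' =>
        simp [R, en] at h hu ⊢; exact ⟨⟨h.1, hu⟩, h.2⟩

theorem tok_dword {a L} (h : WF a L d0) : (en a = 0 → IsDWord (flat L)) ∧
    (en a = 1 → ∃ q p, IsInnerWord q ∧ IsDWord p ∧ flat L = q ++ Step.E :: p) := by
  induction L generalizing a with
  | nil =>
    simp [R, st] at h
    exact ⟨fun _ => .nil, fun h1 => by omega⟩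
  | cons t L ih =>
    simp at h
    have ih' := ih h.2
    have h1 := h.1.1
    cases t <;> simp only [st] at h1 <;> simp [en, tk] at ih' <;> simp [h1, tk]
    · exact .dcons ih'
    · obtain ⟨q, hq, p, hp, e⟩ := ih'
      rw [e]; exact .block hq hp
    · exact ⟨[], .nil, _, ih', rfl⟩
    · obtain ⟨q, hq, p, hp, e⟩ := ih'
      rw [e]; exact ⟨_, .dcons hq, p, hp, rfl⟩
    · obtain ⟨q, hq, p, hp, e⟩ := ih'
      rw [e]; exact ⟨[], .nil, _, .block hq hp, rfl⟩
    · obtain ⟨q, hq, p, hp, e⟩ := ih'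
      rename_i k
      rw [e]; exact ⟨_, .peak (k := k+1) (Nat.succ_pos _) hq, p, hp, by simp⟩

theorem prefix_flat {L p} (h : p <+: flat L) : p = flat L ∨
    ∃ L1 c L2 r, L = L1 ++ c :: L2 ∧ p = flat L1 ++ r ∧ r <+: tk c ∧ r ≠ tk c := by
  induction L generalizing p with
  | nil => left; simpa using h
  | cons t L ih =>
    obtain ⟨s, hs⟩ := h
    rw [flat_cons, List.append_eq_append_iff] at hs
    have key : ∀ a, flat L = a ++ s → p = tk t ++ a → p = flat (t :: L) ∨
      ∃ L1 c L2 r, t :: L = L1 ++ c :: L2 ∧ p = flat L1 ++ r ∧ r <+: tk c ∧ r ≠ tk c := by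
      rintro a h1 h2
      rcases ih (p := a) ⟨s, h1.symm⟩ with rfl | ⟨L1, c, L2, r, rfl, rfl, h3, h4⟩
      · left; simp [h2]
      · right; exact ⟨t :: L1, c, L2, r, by simp, by simp [h2], h3, h4⟩
    rcases hs with ⟨a, h1, h2⟩ | ⟨a, h1, h2⟩
    · by_cases hp : p = tk t
      · have : a = [] := by simpa [hp] using h1
        subst this
        exact key [] (by simpa using h2.symm) (by simp [hp])
      · right; exact ⟨[], t, L, p, rfl, rfl, ⟨a, h1.symm⟩, hp⟩
    · exact key a h2 h1

theorem pre_tk {r c} (h : r <+: tk c) (hr : r ≠ tk c) :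
    posX r ≤ posY r + st c ∧ (st c + posY r = posX r + 1 → r = []) := by
  obtain ⟨s, hs⟩ := h
  cases c with
  | peak k =>
    simp only [tk] at hs hr
    rw [List.append_eq_append_iff] at hs
    rcases hs with ⟨a, h1, h2⟩ | ⟨a, h1, h2⟩
    · have := (List.append_eq_replicate_iff.1 h1.symm).2.1
      rw [this]
      simp [posX, posY, st, List.count_replicate]
    · have h3 := (List.append_eq_replicate_iff.1 h2.symm)
      have h4 : a.length ≠ k + 1 := by
        intro h
        apply hr
        rw [h1, h3.2.1, h]
      have h5 := h3.1
      rw [h1, h3.2.1]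
      simp [posX, posY, st, List.count_replicate]
      omega
  | notch =>
    rcases r with _ | ⟨x, _ | ⟨y, r⟩⟩
    · simp [posX, posY, st]
    · simp [tk] at hs; simp [hs.1, posX, posY, st]
    · simp [tk] at hs; simp [tk, hs] at hr
  | _ =>
    rcases r with _ | ⟨x, r⟩
    · simp [posX, posY, st]
    · simp [tk] at hs; simp [tk, hs] at hr

theorem WF_prefix {L} (h : WF d0 L d0) : IsSchroderPrefix (flat L) := by
  intro q hq
  rcases prefix_flat hq with rfl | ⟨L1, c, L2, r, rfl, rfl, h3, h4⟩
  · have := pos_flat h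
    simp [en, st] at this; omega
  · rw [WF_append] at h
    have := (pos_flat h.1).2
    have h5 := (pre_tk h3 h4).1
    simp [en] at this ⊢; omega

theorem memD_iff (n p) : MemD n p ↔ ∃ L, WF d0 L d0 ∧ flat L = p ∧ w L = 2 * n := by
  constructor
  · rintro ⟨h1, h2, h3, h4⟩
    obtain ⟨L, h, rfl⟩ := dword_tok h1
    have := pos_flat h
    exact ⟨L, h, rfl, by omega⟩
  · rintro ⟨L, h, rfl, h2⟩
    have h3 := pos_flat h
    simp only [en, st] at h3
    exact ⟨(tok_dword h).1 rfl, WF_prefix h, by omega, by omega⟩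

theorem memCal_iff (i p) : (MemCalD p ∧ posX p + 1 = i ∧ posY p = i) ↔
    ∃ M, WF d0 M lev ∧ flat M = p ∧ w M + 1 = 2 * i := by
  constructor
  · rintro ⟨⟨m, q, hp, hq⟩, h1, h2⟩
    obtain ⟨L, h, rfl, h3⟩ := (memD_iff _ _).1 hq
    rcases prefix_flat hp with rfl | ⟨L1, c, L2, r, rfl, rfl, h3, h4⟩
    · have := pos_flat h
      simp [en, st] at this; omega
    · rw [WF_append] at h
      have h5 := (pos_flat h.1)
      have h6 := (pre_tk h3 h4).2
      simp [en] at h5 h1 h2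
      obtain rfl := h6 (by omega)
      have e1 : posX [] = 0 := rfl
      have e2 : posY [] = 0 := rfl
      refine ⟨L1, WF_last h.1 (show st c = 1 by omega) (by simp), by simp, by omega⟩
  · rintro ⟨M, h, rfl, h2⟩
    have h3 := pos_flat h
    simp only [en, st] at h3
    refine ⟨?_, by omega, by omega⟩
    refine ⟨i, flat (M ++ [down]), by simp, (memD_iff _ _).2 ⟨_, ?_, rfl, ?_⟩⟩
    · simp; exact ⟨WF_last h rfl (by simp), by simp [R, en, st]⟩
    · simp [wt]; omega

/-! counting -/

def As (m : ℕ) : Set (List Tok) := {M | WF d0 M d0 ∧ w M = 2 * m}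
def Hs (m : ℕ) : Set (List Tok) := {M | WF d0 M lev ∧ w M + 1 = 2 * m}
def Ks (m : ℕ) : Set (List Tok) := {M | WF d0 M lev ∧ w M < 2 * m}
def Ss (m : ℕ) : Set (List Tok) := {M | WF d0 M d0 ∧ w M = 4 * m ∧ sig M = M}

theorem bSeq_eq (i) : bSeq i = (Hs i).ncard := by
  rw [bSeq, ← Set.ncard_image_of_injOn (f := flat) (s := Hs i)]
  · congr 1
    ext p
    simp only [Set.mem_ofPred_eq, memCal_iff, Set.mem_image, Hs]
    exact ⟨fun ⟨M, a, b, c⟩ => ⟨M, ⟨a, c⟩, b⟩, fun ⟨M, ⟨a, c⟩, b⟩ => ⟨M, a, b, c⟩⟩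
  · intro L hL M hM h
    have := flat_inj (a := d0) (a' := d0) (L := L ++ [down]) (L' := M ++ [down])
      (by simp; exact ⟨WF_last hL.1 rfl (by simp), by simp [R, en, st]⟩)
      (by simp; exact ⟨WF_last hM.1 rfl (by simp), by simp [R, en, st]⟩) rfl (by simp [h])
    simpa using this

theorem sym_eq (n) : Set.ncard {p : List Step | MemD (2 * n) p ∧ revPath (psi p) = p}
    = (Ss n).ncard := by
  rw [← Set.ncard_image_of_injOn (f := flat) (s := Ss n)]
  · congr 1
    ext p
    simp only [Set.mem_ofPred_eq, memD_iff, Set.mem_image, Ss]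
    constructor
    · rintro ⟨⟨L, h, rfl, h2⟩, h3⟩
      rw [revpsi h] at h3
      exact ⟨L, ⟨h, by omega, flat_inj ((WF_sig _ _ _).2 h) h rfl h3⟩, rfl⟩
    · rintro ⟨L, ⟨h, h1, h2⟩, rfl⟩
      exact ⟨⟨L, h, rfl, by omega⟩, by rw [revpsi h, h2]⟩
  · intro L hL M hM h
    exact flat_inj hL.1 hM.1 rfl h

theorem fin_w (m : ℕ) : {L : List Tok | w L ≤ m}.Finite := by
  induction m using Nat.strong_induction_on with
  | _ m ih =>
    have hT : ({d0, up, down, lev, notch} ∪ peak '' (Set.Iic m) : Set Tok).Finite :=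
      (Set.toFinite _).union ((Set.finite_Iic m).image _)
    rcases m with _ | m
    · refine (Set.finite_singleton []).subset ?_
      rintro (_ | ⟨t, L⟩) h
      · rfl
      · cases t <;> simp [wt] at h
    · refine ((Set.finite_singleton []).union
        (Set.Finite.image2 List.cons hT (ih m (by omega)))).subset ?_
      rintro (_ | ⟨t, L⟩) h
      · left; rfl
      · right
        simp only [Set.mem_ofPred_eq, w_cons] at h
        refine ⟨t, ?_, L, ?_, rfl⟩
        · cases t <;> simp [wt] at h ⊢
          omega
        · have : 1 ≤ wt t := by cases t <;> simp [wt]; omega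
          simp only [Set.mem_ofPred_eq]; omega

theorem As_fin (m) : (As m).Finite := (fin_w (2*m)).subset fun M h => by
  have := h.2; simp; omega
theorem Hs_fin (m) : (Hs m).Finite := (fin_w (2*m)).subset fun M h => by
  have := h.2; simp; omega
theorem Ks_fin (m) : (Ks m).Finite := (fin_w (2*m)).subset fun M h => by
  have := h.2; simp; omega

theorem par {M b} (h : WF d0 M b) : w M % 2 = st b := by
  have := pos_flat h
  have h2 : st b ≤ 1 := by cases b <;> simp [st]
  simp only [en] at this
  omega

theorem As_zero : As 0 = {[]} := by
  ext M
  simp only [As, Set.mem_ofPred_eq, Set.mem_singleton_iff]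
  constructor
  · rintro ⟨-, h⟩
    rcases M with _ | ⟨t, L⟩
    · rfl
    · cases t <;> simp [wt] at h
  · rintro rfl; simp [R, en, st]

theorem Hs_zero : Hs 0 = ∅ := by
  ext M; simp [Hs]

theorem Ks_zero : Ks 0 = ∅ := by
  ext M; simp [Ks]

theorem Hs_one : Hs 1 = {[up]} := by
  ext M
  simp only [Hs, Set.mem_ofPred_eq, Set.mem_singleton_iff]
  constructor
  · rintro ⟨h', h⟩
    rcases M with _ | ⟨t, _ | ⟨t', L⟩⟩
    · simp at h
    · cases t <;> simp [wt] at h ⊢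
      simp [R, en, st] at h'
    · cases t <;> cases t' <;> simp [wt] at h <;> omega
  · rintro rfl; simp [R, en, st, wt]

theorem As_succ (m) : As (m+1) = (· ++ [d0]) '' As m ∪ (· ++ [down]) '' Hs (m+1) := by
  ext M
  simp only [As, Hs, Set.mem_ofPred_eq, Set.mem_union, Set.mem_image]
  constructor
  · rintro ⟨h, h2⟩
    rcases List.eq_nil_or_concat M with rfl | ⟨L, t, rfl⟩
    · simp at h2
    · simp at h h2
      cases t <;> simp [R, en, st] at h <;> simp [wt] at h2
      · exact .inl ⟨L, ⟨h, by omega⟩, by simp⟩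
      · exact .inr ⟨L, ⟨WF_last h rfl (by simp), by omega⟩, by simp⟩
  · rintro (⟨L, ⟨h, h2⟩, rfl⟩ | ⟨L, ⟨h, h2⟩, rfl⟩)
    · simp [h, wt, R, en, st]; omega
    · simp [WF_last (c := down) h rfl (by simp), wt, R, en, st]; omega

theorem Ks_succ (m) : Ks (m+1) = Ks m ∪ Hs (m+1) := by
  ext M
  simp only [Ks, Hs, Set.mem_ofPred_eq, Set.mem_union]
  constructor
  · rintro ⟨h, h2⟩
    have := par h
    simp only [st] at this
    by_cases h3 : w M < 2 * m
    · exact .inl ⟨h, h3⟩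
    · exact .inr ⟨h, by omega⟩
  · rintro (⟨h, h2⟩ | ⟨h, h2⟩) <;> exact ⟨h, by omega⟩

theorem Hs_succ (m) : Hs (m+2) = (· ++ [d0, up]) '' As m ∪ (· ++ [lev]) '' Hs (m+1) ∪
    (· ++ [notch]) '' Hs (m+1) ∪ (fun M => M ++ [peak ((2 * m + 1 - w M) / 2)]) '' Ks (m+1) := by
  ext M
  simp only [As, Hs, Ks, Set.mem_ofPred_eq, Set.mem_union, Set.mem_image]
  constructor
  · rintro ⟨h, h2⟩
    rcases List.eq_nil_or_concat M with rfl | ⟨L, t, rfl⟩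
    · simp at h2; omega
    · simp at h h2
      cases t <;> simp [R, en, st] at h <;> simp [wt] at h2
      · left; left; left
        rcases List.eq_nil_or_concat L with rfl | ⟨L, t, rfl⟩
        · simp at h2
        · simp at h h2
          cases t <;> simp [R, en, st] at h
          simp [wt] at h2
          exact ⟨L, ⟨h, by omega⟩, by simp⟩
      · exact .inl (.inl (.inr ⟨L, ⟨h, by omega⟩, by simp⟩))
      · exact .inl (.inr ⟨L, ⟨WF_last h rfl (by simp), by omega⟩, by simp⟩)
      · refine .inr ⟨L, ⟨WF_last h rfl (by simp), by omega⟩, ?_⟩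
        simp; omega
  · rintro (((⟨L, ⟨h, h2⟩, rfl⟩ | ⟨L, ⟨h, h2⟩, rfl⟩) | ⟨L, ⟨h, h2⟩, rfl⟩) | ⟨L, ⟨h, h2⟩, rfl⟩)
    · simp [h, wt, WF_append, R, en, st]; omega
    · simp [h, wt, R, en, st]; omega
    · simp [WF_last (c := notch) h rfl (by simp), wt, R, en, st]; omega
    · have := par h
      simp only [st] at this
      refine ⟨?_, ?_⟩
      · simp only [WF_concat]
        exact ⟨WF_last h rfl (by simp), by simp [R, en, st]⟩
      · simp [wt]; omega

theorem sym_split (L : List Tok) (h : sig L = L) : (∃ M, L = M ++ sig M) ∨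
    ∃ M c, sg c = c ∧ L = M ++ c :: sig M := by
  obtain ⟨k, hk | hk⟩ := Nat.even_or_odd' L.length
  · left
    refine ⟨L.take k, ?_⟩
    have h1 := List.take_append_drop k L
    have h2 : sig (L.drop k) ++ sig (L.take k) = L.take k ++ L.drop k := by
      rw [← sig_append, h1, h]
    have h3 := List.append_inj_right h2 (by simp; omega)
    rw [h3, h1]
  · right
    have h1 := List.take_append_drop k L
    rcases hd : L.drop k with _ | ⟨c, N⟩
    · have := congrArg List.length hd; simp at this; omega
    · have hl := congrArg List.length hd; simp at hl
      rw [hd] at h1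
      have h2 : sig N ++ sg c :: sig (L.take k) = L.take k ++ c :: N := by
        have h4 := congrArg sig h1
        rw [h, sig_append, sig_cons] at h4
        rw [h1]; simpa using h4
      have h3 := List.append_inj_right h2 (by simp; omega)
      simp at h3
      exact ⟨L.take k, c, h3.1, by rw [h3.2, h1]⟩

theorem Ss_succ (n) : Ss (n+1) = (fun M => M ++ [d0, d0] ++ sig M) '' As n ∪
    (fun M => M ++ [peak (2 * n + 1 - w M)] ++ sig M) '' Ks (n+1) := by
  ext L
  simp only [As, Ss, Ks, Set.mem_ofPred_eq, Set.mem_union, Set.mem_image]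
  constructor
  · rintro ⟨h, h2, h3⟩
    rcases sym_split L h3 with ⟨M, rfl⟩ | ⟨M, c, hc, rfl⟩
    · left
      simp at h2
      rcases List.eq_nil_or_concat M with rfl | ⟨M, t, rfl⟩
      · simp at h2
      · simp [WF_append] at h h2
        have := par h.1
        cases t <;> simp [st, wt, R, sg, tau, rho, en] at this h2 h <;> try omega
        refine ⟨M, ⟨h.1, by omega⟩, by simp [sg, tau, rho]⟩
    · right
      simp at h2
      rw [WF_append] at h
      have := par h.1
      cases c <;> simp [sg, tau, rho] at hc <;> simp [st, wt] at this h2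
      · omega
      · refine ⟨M, ⟨WF_last h.1 rfl (by simp), by omega⟩, ?_⟩
        simp; omega
  · rintro (⟨M, ⟨h, h2⟩, rfl⟩ | ⟨M, ⟨h, h2⟩, rfl⟩)
    · have h' := (WF_sig _ _ _).2 h
      simp only [sg, tau, rho] at h'
      simp [WF_append, h, h', wt, sg, tau, rho]
      simp [R, en, st]; omega
    · have h1 := WF_last (c := peak (2 * n + 1 - w M)) h rfl (by simp)
      have h' := (WF_sig _ _ _).2 h1
      simp only [sg, tau, rho] at h'
      simp [WF_append, h1, h', wt, sg, tau, rho]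
      omega

theorem inj_app (N : List Tok) : Function.Injective (fun M : List Tok => M ++ N) :=
  fun _ _ h => List.append_cancel_right h

theorem inj_app1 (f : List Tok → Tok) : Function.Injective (fun M : List Tok => M ++ [f M]) :=
  fun A B h => (List.append_inj' h rfl).1

theorem inj_mid (f : List Tok → List Tok) (c : ℕ) (hf : ∀ M, (f M).length = c) :
    Function.Injective (fun M : List Tok => M ++ f M ++ sig M) := by
  intro A B h
  simp only [List.append_assoc] at h
  have := congrArg List.length h
  simp [hf] at this
  exact (List.append_inj h (by omega)).1

theorem cA (m) : (As (m+1)).ncard = (As m).ncard + (Hs (m+1)).ncard := by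
  rw [As_succ, Set.ncard_union_eq _ ((As_fin _).image _) ((Hs_fin _).image _), Set.ncard_image_of_injective _ (inj_app _),
    Set.ncard_image_of_injective _ (inj_app _)]
  · rw [Set.disjoint_left]
    rintro _ ⟨A, _, rfl⟩ ⟨B, _, h⟩
    simpa using (List.append_inj' h rfl).2

theorem cK (m) : (Ks (m+1)).ncard = (Ks m).ncard + (Hs (m+1)).ncard := by
  rw [Ks_succ, Set.ncard_union_eq _ (Ks_fin _) (Hs_fin _)]
  rw [Set.disjoint_left]
  rintro _ h h'
  have := h.2
  have := h'.2
  omega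

theorem cH (m) : (Hs (m+2)).ncard = (As m).ncard + 2 * (Hs (m+1)).ncard + (Ks (m+1)).ncard := by
  have f1 := (As_fin m).image (· ++ [d0, up])
  have f2 := (Hs_fin (m+1)).image (· ++ [lev])
  have f3 := (Hs_fin (m+1)).image (· ++ [notch])
  have f4 := (Ks_fin (m+1)).image (fun M => M ++ [peak ((2 * m + 1 - w M) / 2)])
  rw [Hs_succ, Set.ncard_union_eq _ ((f1.union f2).union f3) f4,
    Set.ncard_union_eq _ (f1.union f2) f3, Set.ncard_union_eq _ f1 f2,
    Set.ncard_image_of_injective _ (inj_app _), Set.ncard_image_of_injective _ (inj_app _),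
    Set.ncard_image_of_injective _ (inj_app _),
    Set.ncard_image_of_injective _ (inj_app1 (fun M => peak ((2 * m + 1 - w M) / 2)))]
  · ring
  · rw [Set.disjoint_left]
    rintro _ ⟨A, _, rfl⟩ ⟨B, _, h⟩
    have := congrArg List.getLast? h
    simp at this
  · rw [Set.disjoint_left]
    rintro _ (⟨A, _, rfl⟩ | ⟨A, _, rfl⟩) ⟨B, _, h⟩ <;>
    · have := congrArg List.getLast? h
      simp at this
  · rw [Set.disjoint_left]
    rintro _ ((⟨A, _, rfl⟩ | ⟨A, _, rfl⟩) | ⟨A, _, rfl⟩) ⟨B, _, h⟩ <;>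
    · have := congrArg List.getLast? h
      simp at this

theorem cS (n) : (Ss (n+1)).ncard = (As n).ncard + (Ks (n+1)).ncard := by
  rw [Ss_succ, Set.ncard_union_eq _ ((As_fin _).image _) ((Ks_fin _).image _),
    Set.ncard_image_of_injective _ (inj_mid (fun _ => [d0, d0]) 2 (by simp)),
    Set.ncard_image_of_injective _ (inj_mid (fun M => [peak (2 * n + 1 - w M)]) 1 (by simp))]
  rw [Set.disjoint_left]
  rintro _ ⟨A, _, rfl⟩ ⟨B, _, h⟩
  have := congrArg List.length h
  simp at this
  omega

end Schr

theorem stmt_11 :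
    ∀ n : ℕ, 1 ≤ n →
      (Set.ncard {p : List Step | MemD (2 * n) p ∧ revPath (psi p) = p} : ℤ) =
        2 * bSeq n - bSeq (n - 1) := by
  intro n hn
  rw [Schr.sym_eq, Schr.bSeq_eq, Schr.bSeq_eq]
  rcases n with _ | _ | n
  · omega
  · have h1 := Schr.cS 0
    have h2 := Schr.cK 0
    simp only [zero_add, Nat.sub_self, Schr.As_zero, Schr.Ks_zero, Schr.Hs_zero, Schr.Hs_one,
      Set.ncard_singleton, Set.ncard_empty] at h1 h2 ⊢
    rw [h1, h2]; rfl
  · have h1 := Schr.cS (n+1)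
    have h2 := Schr.cK (n+1)
    have h3 := Schr.cH n
    have h4 := Schr.cA n
    rw [show n + 1 + 1 - 1 = n + 1 by omega]
    simp only [add_assoc, Nat.reduceAdd] at h1 h2 h3 h4 ⊢
    omega
end

section
/- For every n ≥ 1, the number of Schröder paths p ∈ D_{2n−1} satisfying rev(ψ(p)) = p equals the number of Schröder paths p ∈ D_{2n} satisfying rev(ψ(p)) = p. -/
inductive Tok : Type
  | d : Tok
  | n : Tok
  | e : Tok
  | l : Tok
  | m : Tok
  | p (k : ℕ) : Tok

namespace Tok

def R : Tok → Tok → Prop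
  | d, d => True
  | d, n => True
  | e, d => True
  | n, e => True
  | n, l => True
  | n, m => True
  | n, p _ => True
  | l, e => True
  | l, l => True
  | l, m => True
  | l, p _ => True
  | m, e => True
  | m, l => True
  | m, m => True
  | m, p _ => True
  | p _, e => True
  | p _, l => True
  | p _, m => True
  | p _, p _ => True
  | _, _ => False

def bar : Tok → Tok
  | d => d
  | n => e
  | e => n
  | l => m
  | m => l
  | p k => p k

def sw : Tok → Tok
  | l => m
  | m => l
  | t => t

def ex : Tok → List Step
  | d => [Step.D]
  | n => [Step.N]
  | e => [Step.E]
  | l => [Step.D]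
  | m => [Step.E, Step.N]
  | p k => List.replicate (k+1) Step.N ++ List.replicate (k+1) Step.E

def exs (w : List Tok) : List Step := w.flatMap ex

@[simp] theorem exs_nil : exs [] = [] := rfl
@[simp] theorem exs_cons (a : Tok) (w : List Tok) : exs (a :: w) = ex a ++ exs w := rfl
@[simp] theorem exs_append (v w : List Tok) : exs (v ++ w) = exs v ++ exs w := by
  simp [exs]

def ht : Tok → ℕ
  | d => 0
  | e => 0
  | _ => 1

def sz : Tok → ℕ
  | d => 2
  | n => 1
  | e => 1
  | l => 2
  | m => 2
  | p k => 2 * (k+1)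

def szs (w : List Tok) : ℕ := (w.map sz).sum

@[simp] theorem szs_nil : szs [] = 0 := rfl
@[simp] theorem szs_cons (a : Tok) (w : List Tok) : szs (a :: w) = sz a + szs w := by simp [szs]
@[simp] theorem szs_append (v w : List Tok) : szs (v ++ w) = szs v + szs w := by simp [szs]

def V (a : Tok) (w : List Tok) : Prop := List.IsChain R (a :: (w ++ [d]))

theorem V_nil (a : Tok) : V a [] ↔ R a d := by simp [V]
theorem V_cons (a b : Tok) (w : List Tok) : V a (b :: w) ↔ R a b ∧ V b w := by simp [V]

theorem R_bar (a b : Tok) : R (bar b) (bar a) ↔ R a b := by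
  cases a <;> cases b <;> simp [R, bar]

theorem bar_bar (a : Tok) : bar (bar a) = a := by cases a <;> rfl
theorem sz_bar (a : Tok) : sz (bar a) = sz a := by cases a <;> rfl

def br (w : List Tok) : List Tok := (w.map bar).reverse

theorem br_append (v w : List Tok) : br (v ++ w) = br w ++ br v := by simp [br]
theorem br_cons (a : Tok) (w : List Tok) : br (a :: w) = br w ++ [bar a] := by simp [br]
@[simp] theorem br_nil : br [] = [] := rfl
theorem br_br (w : List Tok) : br (br w) = w := by
  simp [br, Function.comp_def, bar_bar]
@[simp] theorem length_br (w : List Tok) : (br w).length = w.length := by simp [br]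
@[simp] theorem szs_br (w : List Tok) : szs (br w) = szs w := by
  simp [br, szs, Function.comp_def, sz_bar]

theorem chain_br (w : List Tok) : List.IsChain R (br w) ↔ List.IsChain R w := by
  simp only [br, List.isChain_reverse, List.isChain_map, flip, R_bar]

theorem V_parity (w : List Tok) : ∀ a, V a w → szs w % 2 = ht a := by
  induction w with
  | nil => intro a h; rw [V_nil] at h; cases a <;> simp_all [R, ht]
  | cons b w ih =>
    intro a h
    rw [V_cons] at h
    have := ih b h.2
    have h1 := h.1
    rw [szs_cons]
    cases a <;> cases b <;> simp_all [R, ht, sz] <;> omega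

/-! validity of palindromes -/
theorem V_mid (c : Tok) (hc : bar c = c) (x : List Tok) :
    V d (br x ++ c :: x) ↔ V c x := by
  have : d :: ((br x ++ c :: x) ++ [d]) = br (x ++ [d]) ++ c :: (x ++ [d]) := by
    simp [br, bar]
  unfold V
  rw [this, List.isChain_split]
  have h2 : br (x ++ [d]) ++ [c] = br (c :: (x ++ [d])) := by rw [br_cons, hc]
  rw [h2, chain_br, and_self]

theorem V_mid0 (b : Tok) (z : List Tok) :
    V d (br (b :: z) ++ b :: z) ↔ R (bar b) b ∧ V b z := by
  have : d :: ((br (b :: z) ++ b :: z) ++ [d]) = br (b :: (z ++ [d])) ++ (b :: (z ++ [d])) := by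
    simp [br, bar]
  unfold V
  rw [this, List.isChain_append, chain_br]
  simp [br_cons]
  tauto

/-! expand facts -/
theorem count_ex (a : Tok) : posX (ex a) + posY (ex a) = sz a := by
  cases a <;> simp [ex, posX, posY, sz, List.count_replicate] <;> omega

theorem count_exs (w : List Tok) : posX (exs w) + posY (exs w) = szs w := by
  induction w with
  | nil => rfl
  | cons a w ih =>
    have := count_ex a
    simp only [exs_cons, szs_cons, posX, posY, List.count_append] at *
    omega

def GE (h : ℕ) (p : List Step) : Prop := ∀ q : List Step, q <+: p → posX q ≤ posY q + h

theorem GE_nil (h : ℕ) : GE h [] := by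
  intro q hq
  simp at hq; subst hq; simp [posX]
theorem GE_N {h : ℕ} {p : List Step} (H : GE (h+1) p) : GE h (Step.N :: p) := by
  intro q hq
  rcases List.prefix_cons_iff.1 hq with rfl | ⟨t, rfl, ht⟩
  · simp [posX]
  · have := H t ht
    simp [posX, posY] at *; omega
theorem GE_D {h : ℕ} {p : List Step} (H : GE h p) : GE h (Step.D :: p) := by
  intro q hq
  rcases List.prefix_cons_iff.1 hq with rfl | ⟨t, rfl, ht⟩
  · simp [posX]
  · have := H t ht
    simp [posX, posY] at *; omega
theorem GE_E {h : ℕ} {p : List Step} (H : GE h p) : GE (h+1) (Step.E :: p) := by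
  intro q hq
  rcases List.prefix_cons_iff.1 hq with rfl | ⟨t, rfl, ht⟩
  · simp [posX]
  · have := H t ht
    simp [posX, posY] at *; omega
theorem GE_Es {h : ℕ} {p : List Step} (H : GE h p) (k : ℕ) :
    GE (h+k) (List.replicate k Step.E ++ p) := by
  induction k with
  | zero => simpa
  | succ k ih => exact GE_E ih
theorem GE_Ns {p : List Step} (k : ℕ) : ∀ {h : ℕ}, GE (h+k) p →
    GE h (List.replicate k Step.N ++ p) := by
  induction k with
  | zero => intro h H; simpa using H
  | succ k ih => intro h H; exact GE_N (ih (by convert H using 1; omega))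

theorem V_GE (w : List Tok) : ∀ a, V a w → GE (ht a) (exs w) ∧
    posX (exs w) = posY (exs w) + ht a := by
  induction w with
  | nil =>
    intro a h
    rw [V_nil] at h
    refine ⟨GE_nil _, ?_⟩
    cases a <;> simp_all [R, ht, posX, posY]
  | cons b w ih =>
    intro a h
    rw [V_cons] at h
    obtain ⟨i1, i2⟩ := ih b h.2
    have h1 := h.1
    constructor
    · cases b
      case d => have : ht a = 0 := by cases a <;> simp_all [R, ht]
                rw [this]; exact GE_D i1
      case n => have : ht a = 0 := by cases a <;> simp_all [R, ht]
                rw [this]; exact GE_N i1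
      case e => have : ht a = 1 := by cases a <;> simp_all [R, ht]
                rw [this]; exact GE_E i1
      case l => have : ht a = 1 := by cases a <;> simp_all [R, ht]
                rw [this]; exact GE_D i1
      case m => have : ht a = 1 := by cases a <;> simp_all [R, ht]
                rw [this]; exact GE_E (GE_N i1)
      case p k =>
        have : ht a = 1 := by cases a <;> simp_all [R, ht]
        rw [this, exs_cons, ex, List.append_assoc]
        exact GE_Ns _ (GE_Es i1 _)
    · have : posX (ex b) + ht b = posY (ex b) + ht a := by
        cases a <;> cases b <;> simp_all [R, ht, ex, posX, posY, List.count_replicate]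
      simp only [exs_cons, posX, posY, List.count_append] at *
      omega

/-! psi -/
theorem psi_N (h : ℕ) (r : List Step) : psiAux h (Step.N :: r) = Step.N :: psiAux (h+1) r := by
  rw [psiAux.eq_def]
  rcases h with _ | _ | h <;> rfl
theorem psi_E (h : ℕ) (r : List Step) :
    psiAux (h+2) (Step.E :: r) = Step.E :: psiAux (h+1) r := by
  rw [psiAux.eq_def]; simp
theorem psi_Ns (r : List Step) (k : ℕ) : ∀ h, psiAux h (List.replicate k Step.N ++ r) =
    List.replicate k Step.N ++ psiAux (h+k) r := by
  induction k with
  | zero => simp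
  | succ k ih =>
    intro h
    simp only [List.replicate_succ, List.cons_append, psi_N, ih]
    rw [show h + 1 + k = h + (k+1) by omega]
theorem psi_Es (r : List Step) (k : ℕ) : psiAux (1+k) (List.replicate k Step.E ++ r) =
    List.replicate k Step.E ++ psiAux 1 r := by
  induction k with
  | zero => simp
  | succ k ih =>
    simp only [List.replicate_succ, List.cons_append]
    rw [show 1 + (k+1) = k + 2 by omega, psi_E, show k + 1 = 1 + k by omega, ih]

theorem psi_exs (w : List Tok) : ∀ a, V a w → psiAux (ht a) (exs w) = exs (w.map sw) := by
  induction w with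
  | nil => intro a h; rw [psiAux.eq_def]; simp
  | cons b w ih =>
    intro a h
    rw [V_cons] at h
    have i1 := ih b h.2
    have h1 := h.1
    cases b
    case d => have : ht a = 0 := by cases a <;> simp_all [R, ht]
              rw [this, psiAux.eq_def]; simpa [ex, sw, ht] using i1
    case n => have : ht a = 0 := by cases a <;> simp_all [R, ht]
              rw [this]; simpa [ex, sw, ht, psi_N] using i1
    case e =>
      have : ht a = 1 := by cases a <;> simp_all [R, ht]
      rw [this]
      have h2 := h.2
      rcases w with _ | ⟨c, w⟩
      · simp [ex, sw, psiAux.eq_def]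
      · rw [V_cons] at h2
        cases c <;> simp [R] at h2
        simp [ex, sw, ht] at i1 ⊢
        rw [← i1, psiAux.eq_def]
        rfl
    case l => have : ht a = 1 := by cases a <;> simp_all [R, ht]
              rw [this, psiAux.eq_def]; simpa [ex, sw, ht] using i1
    case m => have : ht a = 1 := by cases a <;> simp_all [R, ht]
              rw [this, psiAux.eq_def]; simpa [ex, sw, ht] using i1
    case p k =>
      have : ht a = 1 := by cases a <;> simp_all [R, ht]
      rw [this, exs_cons, ex, List.append_assoc, psi_Ns, psi_Es]
      simp [ht] at i1
      simp only [i1, List.map_cons, sw, exs_cons, ex, List.append_assoc]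

theorem revPath_append (v w : List Step) : revPath (v ++ w) = revPath w ++ revPath v := by
  simp [revPath]

theorem rev_exs (w : List Tok) : revPath (exs (w.map sw)) = exs (br w) := by
  induction w with
  | nil => rfl
  | cons b w ih =>
    rw [br_cons, List.map_cons, exs_cons, revPath_append, ih, exs_append]
    congr 1
    cases b <;> simp [sw, ex, bar, revPath, revStep]

theorem fix_exs (w : List Tok) (h : V d w) : revPath (psi (exs w)) = exs (br w) := by
  rw [← rev_exs, psi, ← psi_exs w d h]; rfl

/-! injectivity -/
theorem rep_inj (j : ℕ) : ∀ (k : ℕ) (x y : List Step),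
    List.replicate j Step.N ++ Step.E :: x = List.replicate k Step.N ++ Step.E :: y → j = k := by
  induction j with
  | zero => intro k x y h; cases k <;> simp_all [List.replicate_succ]
  | succ j ih =>
    intro k x y h
    cases k with
    | zero => simp [List.replicate_succ] at h
    | succ k =>
      simp only [List.replicate_succ, List.cons_append, List.cons.injEq, true_and] at h
      rw [ih k x y h]

theorem V_e (w : List Tok) (h : V e w) (r : List Step) : exs w ≠ Step.N :: r := by
  rcases w with _ | ⟨c, w⟩
  · simp
  · rw [V_cons] at h
    cases c <;> simp [R] at h
    simp [ex]

theorem exs_inj (w : List Tok) : ∀ a v, V a w → V a v → exs w = exs v → w = v := by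
  induction w with
  | nil =>
    intro a v _ _ h
    rcases v with _ | ⟨c, v⟩
    · rfl
    · cases c <;> simp [ex] at h
  | cons b w ih =>
    intro a v hw hv h
    rcases v with _ | ⟨c, v⟩
    · cases b <;> simp [ex] at h
    · rw [V_cons] at hw hv
      have key : b = c → b :: w = c :: v := by
        rintro rfl
        simp only [exs_cons, List.append_cancel_left_eq] at h
        rw [ih _ _ hw.2 hv.2 h]
      apply key
      have e1 := V_e w
      have e2 := V_e v
      obtain ⟨hw1, hw2⟩ := hw
      obtain ⟨hv1, hv2⟩ := hv
      cases b <;> cases c <;> first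
        | rfl
        | (exfalso; simp [ex, List.replicate_succ] at h; done)
        | (exfalso; simp [ex] at h; exact e1 hw2 _ h)
        | (exfalso; simp [ex] at h; exact e2 hv2 _ h.symm)
        | (exfalso; cases a <;> simp_all [R]; done)
        | skip
      rename_i j k
      simp only [exs_cons, ex, List.append_assoc] at h
      have := rep_inj (j+1) (k+1) (List.replicate j Step.E ++ exs w)
        (List.replicate k Step.E ++ exs v) (by simpa [List.replicate_succ] using h)
      congr 1; omega

/-! image -/
theorem inner_exs {q : List Step} (h : IsInnerWord q) :
    ∃ w, exs w = q ∧ ∀ t, V n t → V n (w ++ t) := by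
  have up : ∀ (b : Tok) (t : List Tok), ht b = 1 → V n t → V b t := by
    intro b t hb ht'
    rcases t with _ | ⟨c, t⟩
    · simp [V_nil, R] at ht'
    · rw [V_cons] at *
      refine ⟨?_, ht'.2⟩
      have := ht'.1
      cases b <;> cases c <;> simp_all [R, ht]
  induction h with
  | nil => exact ⟨[], rfl, fun t h => h⟩
  | dcons _ ih =>
    obtain ⟨w, rfl, hw⟩ := ih
    exact ⟨l :: w, rfl, fun t h => (V_cons _ _ _).2 ⟨trivial, up _ _ rfl (hw t h)⟩⟩
  | @peak k p' hk _ ih =>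
    obtain ⟨w, rfl, hw⟩ := ih
    obtain ⟨k, rfl⟩ : ∃ j, k = j + 1 := ⟨k - 1, by omega⟩
    exact ⟨p k :: w, rfl, fun t h => (V_cons _ _ _).2 ⟨trivial, up _ _ rfl (hw t h)⟩⟩

theorem V_m (t : List Tok) : V n t → V m t := by
  rcases t with _ | ⟨c, t⟩
  · simp [V_nil, R]
  · rw [V_cons, V_cons]; cases c <;> simp [R]

theorem dword_exs {q : List Step} (h : IsDWord q) : ∃ w, exs w = q ∧ V d w := by
  induction h with
  | nil => exact ⟨[], rfl, by simp [V_nil, R]⟩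
  | dcons _ ih =>
    obtain ⟨w, rfl, hw⟩ := ih
    exact ⟨d :: w, rfl, (V_cons _ _ _).2 ⟨trivial, hw⟩⟩
  | block hq _ ih =>
    obtain ⟨w, rfl, hw⟩ := ih
    obtain ⟨u, rfl, hu⟩ := inner_exs hq
    rcases w with _ | ⟨c, w⟩
    · refine ⟨n :: (u ++ [e]), by simp [ex], (V_cons _ _ _).2 ⟨trivial, hu _ ?_⟩⟩
      simp [V_cons, V_nil, R]
    · have hw' := hw
      rw [V_cons] at hw
      cases c <;> simp [R] at hw
      · refine ⟨n :: (u ++ e :: d :: w), by simp [ex], (V_cons _ _ _).2 ⟨trivial, hu _ ?_⟩⟩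
        simp [V_cons, R, hw]
      · refine ⟨n :: (u ++ m :: w), by simp [ex], (V_cons _ _ _).2 ⟨trivial, hu _ ?_⟩⟩
        rw [V_cons]
        exact ⟨trivial, V_m _ hw⟩

theorem exs_dword (w : List Tok) : ∀ a, V a w → (ht a = 0 → IsDWord (exs w)) ∧
    (ht a = 1 → ∃ q r, IsInnerWord q ∧ IsDWord r ∧ exs w = q ++ Step.E :: r) := by
  induction w with
  | nil =>
    intro a h
    refine ⟨fun _ => IsDWord.nil, fun h1 => ?_⟩
    rw [V_nil] at h
    cases a <;> simp_all [R, ht]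
  | cons b w ih =>
    intro a h
    rw [V_cons] at h
    obtain ⟨i1, i2⟩ := ih b h.2
    have h1 := h.1
    constructor
    · intro ha
      cases b
      case d => exact IsDWord.dcons (i1 rfl)
      case n =>
        obtain ⟨q, r, hq, hr, he⟩ := i2 rfl
        rw [exs_cons, he]
        exact IsDWord.block hq hr
      all_goals (exfalso; cases a <;> simp_all [R, ht])
    · intro ha
      cases b
      case e => exact ⟨[], _, IsInnerWord.nil, i1 rfl, rfl⟩
      case l =>
        obtain ⟨q, r, hq, hr, he⟩ := i2 rfl
        exact ⟨_, r, IsInnerWord.dcons hq, hr, by simp [ex, he]⟩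
      case m =>
        obtain ⟨q, r, hq, hr, he⟩ := i2 rfl
        exact ⟨[], _, IsInnerWord.nil, IsDWord.block hq hr, by simp [ex, he]⟩
      case p k =>
        obtain ⟨q, r, hq, hr, he⟩ := i2 rfl
        exact ⟨_, r, IsInnerWord.peak (Nat.succ_pos k) hq, hr, by simp [ex, he]⟩
      all_goals (exfalso; cases a <;> simp_all [R, ht])

theorem mem_iff (k : ℕ) (q : List Step) : (MemD k q ∧ revPath (psi q) = q) ↔
    ∃ w, exs w = q ∧ V d w ∧ br w = w ∧ szs w = 2 * k := by
  constructor
  · rintro ⟨⟨h1, -, h2, h3⟩, h4⟩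
    obtain ⟨w, rfl, hw⟩ := dword_exs h1
    rw [fix_exs w hw] at h4
    have hb : V d (br w) := by
      have : d :: (br w ++ [d]) = br (d :: (w ++ [d])) := by simp [br, bar]
      unfold V at *
      rwa [this, chain_br]
    refine ⟨w, rfl, hw, exs_inj _ d _ hb hw h4, ?_⟩
    rw [← count_exs]; omega
  · rintro ⟨w, rfl, hw, hb, hs⟩
    have h1 := V_GE w d hw
    rw [← count_exs] at hs
    have h2 := h1.2
    simp only [ht] at h2
    refine ⟨⟨(exs_dword w d hw).1 rfl, h1.1, by omega, by omega⟩, ?_⟩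
    rw [fix_exs w hw, hb]

theorem pal_split (w : List Tok) (h : br w = w) :
    (∃ x, w = br x ++ x) ∨ ∃ c x, bar c = c ∧ w = br x ++ c :: x := by
  rcases Nat.even_or_odd' w.length with ⟨j, hj | hj⟩
  · left
    refine ⟨w.drop j, ?_⟩
    have h0 := List.take_append_drop j w
    have h1 := h
    rw [← h0, br_append] at h1
    have h2 := List.append_inj_left h1 (by simp; omega)
    rw [h2, h0]
  · right
    have h0 := List.take_append_drop j w
    rcases hd : w.drop j with _ | ⟨c, x⟩
    · have := congrArg List.length hd
      simp at this; omega
    have hl := congrArg List.length hd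
    simp at hl
    rw [hd] at h0
    have h1 := h
    rw [← h0, br_append, br_cons, List.append_assoc] at h1
    obtain ⟨h2, h3⟩ := List.append_inj h1 (by simp; omega)
    simp at h3
    exact ⟨c, x, h3.1, by rw [h2, h0]⟩

def pk : ℕ → List Tok
  | 0 => []
  | k+1 => [p k]

def T (N : ℕ) : Set (List Tok × Bool) :=
  {z | (z.2 = false ∧ V d z.1 ∧ szs z.1 + 2 = 2 * N) ∨ (z.2 = true ∧ V n z.1 ∧ szs z.1 < 2 * N)}

def G (ds : List Tok) (k : ℕ) (z : List Tok × Bool) : List Tok :=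
  br z.1 ++ ((bif z.2 then pk (k - szs z.1) else ds) ++ z.1)

theorem pk_len (k : ℕ) : (pk k).length ≤ 1 := by cases k <;> simp [pk]
theorem pk_d (k : ℕ) (x y : List Tok): pk k ++ x ≠ d :: y ∨ pk k = [] := by
  cases k <;> simp [pk]

theorem V_pk (k : ℕ) (x : List Tok) : V (p k) x ↔ V n x := by
  rcases x with _ | ⟨c, x⟩
  · simp [V_nil, R]
  · rw [V_cons, V_cons]; cases c <;> simp [R]

theorem V_G_pk (k : ℕ) (x : List Tok) (h : V n x) : V d (br x ++ (pk k ++ x)) := by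
  cases k with
  | succ k => exact (V_mid (p k) rfl x).2 ((V_pk k x).2 h)
  | zero =>
    rcases x with _ | ⟨b, z⟩
    · simp [V_nil, R] at h
    · refine (V_mid0 b z).2 ?_
      rw [V_cons] at h
      exact ⟨by cases b <;> simp_all [R, bar], h.2⟩

theorem szs_pk (k : ℕ) : szs (pk k) = 2 * k := by cases k <;> simp [pk, sz]
theorem br_pk (k : ℕ) : br (pk k) = pk k := by cases k <;> simp [pk, br, bar]

theorem G_inj (ds : List Tok) (hds : ds = [d] ∨ ds = [d, d]) (k N : ℕ) :
    Set.InjOn (G ds k) (T N) := by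
  have mixed : ∀ x y j, V d x → V n y → br x ++ (ds ++ x) = br y ++ (pk j ++ y) → False := by
    intro x y j hx hy h
    have hl := congrArg List.length h
    have := pk_len j
    simp at hl
    rcases hds with rfl | rfl
    · simp at hl
      have h2 := List.append_inj_right h (by simp; omega)
      rcases j with _ | j
      · simp [pk] at hl; omega
      · simp [pk] at h2
    · simp at hl
      rcases j with _ | j
      · simp [pk] at hl h
        have h' : (br x ++ [d]) ++ (d :: x) = br y ++ y := by simpa using h
        have h2 := List.append_inj_right h' (by simp; omega)
        rw [← h2, V_cons] at hy
        simp [R] at hy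
      · simp [pk] at hl; omega
  rintro ⟨x, a⟩ hx ⟨y, b⟩ hy h
  simp only [T, Set.mem_ofPred_eq] at hx hy
  cases a <;> cases b <;> simp [G] at h hx hy
  · have hl := congrArg List.length h
    simp at hl
    have h2 := List.append_inj_right h (by simp; omega)
    simp at h2
    simp [h2]
  · exact (mixed _ _ _ hx.1 hy.1 h).elim
  · exact (mixed _ _ _ hy.1 hx.1 h.symm).elim
  · have hl := congrArg List.length h
    have h3 := pk_len (k - szs x)
    have h4 := pk_len (k - szs y)
    simp at hl
    have h2 := List.append_inj_right h (by simp; omega)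
    have h5 := List.append_inj_right h2 (by omega)
    simp [h5]

theorem G_good (ds : List Tok) (k N : ℕ) (hd : (ds = [d] ∧ k + 1 = 2 * N) ∨
    (ds = [d, d] ∧ k = 2 * N)) (z : List Tok × Bool) (hz : z ∈ T N) :
    V d (G ds k z) ∧ br (G ds k z) = G ds k z ∧ szs (G ds k z) = 2 * k := by
  obtain ⟨x, a⟩ := z
  simp only [T, Set.mem_ofPred_eq] at hz
  cases a <;> simp at hz
  · rcases hd with ⟨rfl, hk⟩ | ⟨rfl, hk⟩
    · refine ⟨(V_mid d rfl x).2 hz.1, ?_, ?_⟩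
      · simp [G, br_append, br_br, br_cons, bar]
      · simp [G, sz]; omega
    · refine ⟨?_, ?_, ?_⟩
      · have := (V_mid0 d x).2 ⟨trivial, hz.1⟩
        simpa [G, br_cons, bar] using this
      · simp [G, br_append, br_br, br_cons, bar]
      · simp [G, sz]; omega
  · refine ⟨V_G_pk _ x hz.1, ?_, ?_⟩
    · simp [G, br_append, br_br, br_pk]
    · have := V_parity x n hz.1
      simp only [ht] at this
      simp [G, szs_pk]; omega

theorem G_surj (ds : List Tok) (k N : ℕ) (hN : 1 ≤ N) (hd : (ds = [d] ∧ k + 1 = 2 * N) ∨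
    (ds = [d, d] ∧ k = 2 * N)) (w : List Tok) (h1 : V d w) (h2 : br w = w)
    (h3 : szs w = 2 * k) : ∃ z ∈ T N, G ds k z = w := by
  rcases pal_split w h2 with ⟨x, rfl⟩ | ⟨c, x, hc, rfl⟩
  · simp at h3
    rcases x with _ | ⟨b, y⟩
    · simp at h3; omega
    · rw [V_mid0] at h1
      have hp := V_parity y b h1.2
      by_cases hb : b = d
      · subst hb
        simp [ht, sz] at hp h3
        rcases hd with ⟨rfl, hk⟩ | ⟨rfl, hk⟩
        · omega
        · refine ⟨(y, false), ?_, ?_⟩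
          · left; exact ⟨rfl, h1.2, by simp; omega⟩
          · simp [G, br_cons, bar]
      · have hv : V n (b :: y) := by
          rw [V_cons]
          exact ⟨by cases b <;> simp_all [R, bar], h1.2⟩
        have hp := V_parity _ _ hv
        simp only [ht] at hp
        refine ⟨(b :: y, true), ?_, ?_⟩
        · right; exact ⟨rfl, hv, by simp at *; omega⟩
        · have : k - szs (b :: y) = 0 := by simp at h3 ⊢; omega
          simp [G] at this ⊢
          rw [this]; rfl
  · rw [V_mid c hc] at h1
    have hp := V_parity x c h1
    cases c <;> simp [bar] at hc
    · simp [ht, sz] at hp h3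
      rcases hd with ⟨rfl, hk⟩ | ⟨rfl, hk⟩
      · exact ⟨(x, false), Or.inl ⟨rfl, h1, by simp; omega⟩, by simp [G]⟩
      · omega
    · rename_i j
      simp [ht, sz] at hp h3
      refine ⟨(x, true), Or.inr ⟨rfl, (V_pk j x).1 h1, by simp; omega⟩, ?_⟩
      have : k - szs x = j + 1 := by omega
      simp [G, this, pk]

theorem count_eq (ds : List Tok) (k N : ℕ) (hN : 1 ≤ N) (hd : (ds = [d] ∧ k + 1 = 2 * N) ∨
    (ds = [d, d] ∧ k = 2 * N)) :
    Set.ncard {q : List Step | MemD k q ∧ revPath (psi q) = q} = Set.ncard (T N) := by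
  have : {q : List Step | MemD k q ∧ revPath (psi q) = q} = (fun z => exs (G ds k z)) '' T N := by
    ext q
    rw [Set.mem_ofPred_eq, mem_iff]
    constructor
    · rintro ⟨w, rfl, h1, h2, h3⟩
      obtain ⟨z, hz, rfl⟩ := G_surj ds k N hN hd w h1 h2 h3
      exact ⟨z, hz, rfl⟩
    · rintro ⟨z, hz, rfl⟩
      exact ⟨_, rfl, G_good ds k N hd z hz⟩
  rw [this]
  apply Set.ncard_image_of_injOn
  intro y hy z hz h
  refine G_inj ds (by tauto) k N hy hz ?_
  exact exs_inj _ d _ (G_good ds k N hd y hy).1 (G_good ds k N hd z hz).1 h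

end Tok

theorem stmt_12 :
    ∀ n : ℕ, 1 ≤ n →
      Set.ncard {p : List Step | MemD (2 * n - 1) p ∧ revPath (psi p) = p} =
        Set.ncard {p : List Step | MemD (2 * n) p ∧ revPath (psi p) = p} := by
  intro n hn
  rw [Tok.count_eq [Tok.d] (2 * n - 1) n hn (Or.inl ⟨rfl, by omega⟩),
    Tok.count_eq [Tok.d, Tok.d] (2 * n) n hn (Or.inr ⟨rfl, rfl⟩)]
end
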